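/- arXiv:2005.03693 — 2 statements merged into one kernel-verified Lean document; each statement's English description precedes it below -/
import Mathlib

section
/- Suppose the social welfare function Φ satisfies restricted monotonicity and no belief imposition. Then for every agent i ∈ I and every profile p ∈ R̄^I there is α ∈ ℝ such that φ(p) = (1 − α)·φ(p_{∼i}) + α·π_i. Moreover, if Φ(p_{∼i}) is not complete indifference, then α ≠ 1. -/
open MeasureTheory

/-- An act: a measurable map from states to outcomes. -/
abbrev Act (Ω O : Type*) [MeasurableSpace Ω] [MeasurableSpace O] : Type _ :=
  {f : Ω → O // Measurable f}

/-- Non-atomicity of a measure relative to an explicit σ-algebra `m'`: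
for every `m'`-measurable set of positive measure there is an `m'`-measurable
subset of strictly smaller positive measure. -/
def NonatomicOn {Ω : Type*} [MeasurableSpace Ω] (π : MeasureTheory.Measure Ω)
    (m' : MeasurableSpace Ω) : Prop :=
  ∀ E : Set Ω, MeasurableSet[m'] E → 0 < π E →
    ∃ F : Set Ω, MeasurableSet[m'] F ∧ F ⊆ E ∧ 0 < π F ∧ π F < π E

section Framework

variable {Ω O I : Type*} [mΩ : MeasurableSpace Ω] [mO : MeasurableSpace O]

/-- A belief: a non-atomic (countably additive) probability measure. -/
def IsBelief (π : Measure Ω) : Prop :=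
  IsProbabilityMeasure π ∧ NonatomicOn π mΩ

/-- A utility function: a bounded measurable function on outcomes. -/
def IsUtility (u : O → ℝ) : Prop :=
  Measurable u ∧ ∃ M : ℝ, ∀ x, |u x| ≤ M

/-- A normalized utility function: measurable with infimum 0 and supremum 1. -/
def NormalizedUtility (u : O → ℝ) : Prop :=
  Measurable u ∧ IsGLB (Set.range u) 0 ∧ IsLUB (Set.range u) 1

/-- Member of `𝒰̄`: normalized or identically zero. -/
def NormalizedUtilityBar (u : O → ℝ) : Prop :=
  NormalizedUtility u ∨ u = 0

/-- Subjective expected utility of an act. -/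
noncomputable def ev (π : Measure Ω) (u : O → ℝ) (f : Act Ω O) : ℝ :=
  ∫ ω, u (f.1 ω) ∂π

/-- Preference relations over acts. -/
abbrev Pref (Ω O : Type*) [MeasurableSpace Ω] [MeasurableSpace O] :=
  Act Ω O → Act Ω O → Prop

/-- `(π, u)` represents `r`: `f ≿ g` iff the expected utility of `f` is at least
that of `g`. -/
def Represents (π : Measure Ω) (u : O → ℝ) (r : Pref Ω O) : Prop :=
  ∀ f g : Act Ω O, r f g ↔ ev π u g ≤ ev π u f

/-- A normalized representation: a belief together with a normalized (or zero)
utility function representing the relation. -/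
def NormRep (π : Measure Ω) (u : O → ℝ) (r : Pref Ω O) : Prop :=
  IsBelief π ∧ NormalizedUtilityBar u ∧ Represents π u r

/-- Membership in `R̄`: the relation maximizes subjective expected utility. -/
def IsSEU (r : Pref Ω O) : Prop :=
  ∃ (π : Measure Ω) (u : O → ℝ), IsBelief π ∧ IsUtility u ∧ Represents π u r

/-- Complete indifference: the relation with empty strict part. -/
def CompletelyIndifferent (r : Pref Ω O) : Prop :=
  ∀ f g : Act Ω O, r f g

/-- `π` is a belief representing `r` (together with some utility function). -/
def RepresentsBelief (π : Measure Ω) (r : Pref Ω O) : Prop :=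
  IsBelief π ∧ ∃ u : O → ℝ, IsUtility u ∧ Represents π u r

/-- A preference profile: every agent's relation is SEU-maximizing. -/
def IsProfile (p : I → Pref Ω O) : Prop := ∀ i, IsSEU (p i)

/-- The completely indifferent relation. -/
def indiffRel : Pref Ω O := fun _ _ => True

open Classical in
/-- `p_{∼i}`: replace agent `i`'s relation by complete indifference. -/
noncomputable def updIndiff (p : I → Pref Ω O) (i : I) : I → Pref Ω O :=
  fun j => if j = i then indiffRel else p j

/-- `p_{∼{i,j}}`. -/
noncomputable def updIndiffPair (p : I → Pref Ω O) (i j : I) : I → Pref Ω O :=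
  updIndiff (updIndiff p i) j

open Classical in
/-- `I_p`: the set of concerned agents. -/
noncomputable def concerned [Fintype I] (p : I → Pref Ω O) : Finset I :=
  Finset.univ.filter fun i => ¬ CompletelyIndifferent (p i)

/-- Equivalence of utility functions: equality up to a positive affine
transformation. -/
def UEquiv (u v : O → ℝ) : Prop :=
  ∃ a : ℝ, 0 < a ∧ ∃ b : ℝ, ∀ x, u x = a * v x + b

/-- The beliefs `(πa i)_{i ∈ J}` are affinely independent. -/
def BeliefsAffIndep (J : Finset I) (πa : I → Measure Ω) : Prop :=
  ∀ c : I → ℝ, (∑ i ∈ J, c i) = 0 →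
    (∀ E : Set Ω, MeasurableSet E → (∑ i ∈ J, c i * (πa i E).toReal) = 0) →
    ∀ i ∈ J, c i = 0

/-- The utility functions `(ua i)_{i ∈ J}` are linearly independent: no
nontrivial linear combination of them is a constant function. -/
def UtilsLinIndep (J : Finset I) (ua : I → O → ℝ) : Prop :=
  ∀ c : I → ℝ, (∃ b : ℝ, ∀ x, (∑ i ∈ J, c i * ua i x) = b) → ∀ i ∈ J, c i = 0

/-- The profile has non-degenerate beliefs: the beliefs of any pair and any
triple of concerned agents are affinely independent. -/
def NonDegenerateBeliefs [Fintype I] (p : I → Pref Ω O) (πa : I → Measure Ω) : Prop :=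
  ∀ J : Finset I, J ⊆ concerned p → (J.card = 2 ∨ J.card = 3) → BeliefsAffIndep J πa

/-- The profile has non-degenerate utilities: the utility functions of any pair
and any triple of concerned agents are linearly independent. -/
def NonDegenerateUtils [Fintype I] (p : I → Pref Ω O) (ua : I → O → ℝ) : Prop :=
  ∀ J : Finset I, J ⊆ concerned p → (J.card = 2 ∨ J.card = 3) → UtilsLinIndep J ua

/-- The belief dimension of the beliefs `(πa i)_{i ∈ J}` is at least `n`. -/
def BeliefDimAtLeast (n : ℕ) (J : Finset I) (πa : I → Measure Ω) : Prop :=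
  ∃ E : Fin n → Set Ω, (∀ k, MeasurableSet (E k)) ∧
    ∀ c : Fin n → ℝ, (∀ i ∈ J, (∑ k, c k * (πa i (E k)).toReal) = 0) → ∀ k, c k = 0

/-- The utility dimension of the utility functions `(ua i)_{i ∈ J}` is at
least `n`. -/
def UtilDimAtLeast (n : ℕ) (J : Finset I) (ua : I → O → ℝ) : Prop :=
  ∃ q : Fin n → Measure O, (∀ k, IsProbabilityMeasure (q k)) ∧
    ∀ c : Fin n → ℝ, (∀ i ∈ J, (∑ k, c k * ∫ x, ua i x ∂(q k)) = 0) → ∀ k, c k = 0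

open Classical in
/-- The expected utility function of an SEU relation (via a choice of a
normalized representation). -/
noncomputable def evOf (r : Pref Ω O) : Act Ω O → ℝ :=
  if h : ∃ π : Measure Ω, ∃ u : O → ℝ, NormRep π u r then
    fun f => ev h.choose h.choose_spec.choose f
  else fun _ => 0

/-- The uniform metric on `R`. -/
noncomputable def prefDist (r r' : Pref Ω O) : ℝ :=
  ⨆ f : Act Ω O, |evOf r f - evOf r' f|

/-- Continuity of a real-valued function on `R` with respect to the uniform
metric. -/
def ContOnR (h : Pref Ω O → ℝ) : Prop :=
  ∀ r : Pref Ω O, IsSEU r → ¬ CompletelyIndifferent r →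
    ∀ ε : ℝ, 0 < ε → ∃ δ : ℝ, 0 < δ ∧
      ∀ r' : Pref Ω O, IsSEU r' → ¬ CompletelyIndifferent r' →
        prefDist r r' < δ → |h r' - h r| < ε

/-- Open sets of `R̄`: the whole space `R̄` together with the metrically open
subsets of `R`. -/
def OpenInRbar (S : Set (Pref Ω O)) : Prop :=
  S = {r | IsSEU r} ∨
    ∀ r ∈ S, IsSEU r ∧ ¬ CompletelyIndifferent r ∧
      ∃ ε : ℝ, 0 < ε ∧ ∀ r' : Pref Ω O, IsSEU r' → ¬ CompletelyIndifferent r' →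
        prefDist r r' < ε → r' ∈ S

/-- Restricted monotonicity (on a domain `D` of profiles). -/
def RestrictedMonotonicityOn (D : (I → Pref Ω O) → Prop)
    (Φ : (I → Pref Ω O) → Pref Ω O) : Prop :=
  ∀ (i : I) (p : I → Pref Ω O), D p →
    ∀ πsi πi : Measure Ω,
      RepresentsBelief πsi (Φ (updIndiff p i)) → RepresentsBelief πi (p i) →
      ∀ f g : Act Ω O,
        Φ (updIndiff p i) f g → Φ (updIndiff p i) g f →
        Measure.map f.1 πsi = Measure.map f.1 πi →
        Measure.map g.1 πsi = Measure.map g.1 πi →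
        (p i f g → Φ p f g) ∧ ((p i f g ∧ ¬ p i g f) → (Φ p f g ∧ ¬ Φ p g f))

abbrev RestrictedMonotonicity (Φ : (I → Pref Ω O) → Pref Ω O) : Prop :=
  RestrictedMonotonicityOn IsProfile Φ

/-- Faithfulness (on a domain `D`). -/
def FaithfulOn (D : (I → Pref Ω O) → Prop) (Φ : (I → Pref Ω O) → Pref Ω O) : Prop :=
  ∀ p : I → Pref Ω O, D p → (∀ i, CompletelyIndifferent (p i)) →
    CompletelyIndifferent (Φ p)

abbrev Faithful (Φ : (I → Pref Ω O) → Pref Ω O) : Prop := FaithfulOn IsProfile Φ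

/-- No belief imposition (on a domain `D`). -/
def NoBeliefImpositionOn (D : (I → Pref Ω O) → Prop)
    (Φ : (I → Pref Ω O) → Pref Ω O) : Prop :=
  ∀ (i : I) (p : I → Pref Ω O), D p →
    ¬ CompletelyIndifferent (Φ (updIndiff p i)) →
    ¬ CompletelyIndifferent (Φ p) →
    ¬ CompletelyIndifferent (p i) →
    ∀ πsi π πi : Measure Ω,
      RepresentsBelief πsi (Φ (updIndiff p i)) →
      RepresentsBelief π (Φ p) → RepresentsBelief πi (p i) →
      πsi ≠ πi → π ≠ πi

abbrev NoBeliefImposition (Φ : (I → Pref Ω O) → Pref Ω O) : Prop :=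
  NoBeliefImpositionOn IsProfile Φ

/-- Continuity of an SWF (on a domain `D`), with respect to the topology of
`R̄` and the product topology on profiles. -/
def ContinuousSWFOn (D : (I → Pref Ω O) → Prop)
    (Φ : (I → Pref Ω O) → Pref Ω O) : Prop :=
  ∀ S : Set (Pref Ω O), OpenInRbar S →
    ∀ p : I → Pref Ω O, D p → Φ p ∈ S →
      ∃ T : I → Set (Pref Ω O), (∀ i, OpenInRbar (T i)) ∧ (∀ i, p i ∈ T i) ∧
        ∀ q : I → Pref Ω O, D q → (∀ i, q i ∈ T i) → Φ q ∈ S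

abbrev ContinuousSWF (Φ : (I → Pref Ω O) → Pref Ω O) : Prop :=
  ContinuousSWFOn IsProfile Φ

/-- Anonymity (on a domain `D`). -/
def AnonymousOn (D : (I → Pref Ω O) → Prop)
    (Φ : (I → Pref Ω O) → Pref Ω O) : Prop :=
  ∀ p : I → Pref Ω O, D p → ∀ η : Equiv.Perm I, Φ (fun i => p (η i)) = Φ p

abbrev Anonymous (Φ : (I → Pref Ω O) → Pref Ω O) : Prop := AnonymousOn IsProfile Φ

/-- The regular set of acts `𝒜(ℰ', O')`. -/
def RegularActs (m' : MeasurableSpace Ω) (O' : Set O) : Set (@Act Ω O mΩ mO) :=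
  {f : @Act Ω O mΩ mO | @Measurable Ω O m' mO f.1 ∧ Set.range f.1 ⊆ O'}

/-- `𝒜(ℰ', O')` is co-redundant for `p` (with representing beliefs `πa`). -/
def CoRedundant (m' : MeasurableSpace Ω) (O' : Set O)
    (p : I → @Pref Ω O mΩ mO) (πa : I → @MeasureTheory.Measure Ω mΩ) : Prop :=
  (∀ f : @Act Ω O mΩ mO, ∃ g ∈ @RegularActs Ω O mΩ mO m' O', ∀ i, p i f g ∧ p i g f) ∧
  (∀ i, @NonatomicOn Ω mΩ (πa i) m')

/-- Independence of redundant acts (on a domain `D`). -/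
def IndepRedundantActsOn (D : (I → Pref Ω O) → Prop)
    (Φ : (I → Pref Ω O) → Pref Ω O) : Prop :=
  ∀ (p p' : I → Pref Ω O) (πa πa' : I → Measure Ω),
    D p → D p' →
    (∀ i, RepresentsBelief (πa i) (p i)) →
    (∀ i, RepresentsBelief (πa' i) (p' i)) →
    ∀ (m' : {m : MeasurableSpace Ω // m ≤ mΩ}) (O' : Set O),
      CoRedundant m'.1 O' p πa → CoRedundant m'.1 O' p' πa' →
      (∀ i : I, ∀ f ∈ RegularActs m'.1 O', ∀ g ∈ RegularActs m'.1 O',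
        (p i f g ↔ p' i f g)) →
      ∀ f ∈ RegularActs m'.1 O', ∀ g ∈ RegularActs m'.1 O',
        (Φ p f g ↔ Φ p' f g)

abbrev IndepRedundantActs (Φ : (I → Pref Ω O) → Pref Ω O) : Prop :=
  IndepRedundantActsOn IsProfile Φ

/-- The weighted average of the concerned agents' beliefs with weights `v`. -/
noncomputable def mixBelief [Fintype I] (p : I → Pref Ω O) (πa : I → Measure Ω)
    (v : I → ℝ) : Measure Ω :=
  (ENNReal.ofReal ((∑ i ∈ concerned p, v i)⁻¹)) •
    ∑ i ∈ concerned p, ENNReal.ofReal (v i) • πa i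

/-- The weighted sum of the concerned agents' utility functions with weights
`w`. -/
noncomputable def mixUtil [Fintype I] (p : I → Pref Ω O) (ua : I → O → ℝ)
    (w : I → ℝ) : O → ℝ :=
  fun x => ∑ i ∈ concerned p, w i * ua i x

/-- A common utility profile: every concerned agent's normalized utility
function is equivalent to `u` or to `-u` for a single `u ∈ 𝒰`. -/
def CommonUtilityProfile [Fintype I] (p : I → Pref Ω O) (ua : I → O → ℝ) : Prop :=
  ∃ u : O → ℝ, NormalizedUtility u ∧
    ∀ i ∈ concerned p, UEquiv (ua i) u ∨ UEquiv (ua i) (fun x => - u x)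

end Framework
section Helpers

open Filter Topology

variable {Ω : Type*} [mΩ : MeasurableSpace Ω]

lemma exists_chain_aux (ν : Measure Ω) [IsFiniteMeasure ν]
    (hna : ∀ E, MeasurableSet E → 0 < ν.real E →
      ∃ F, MeasurableSet F ∧ F ⊆ E ∧ 0 < ν.real F ∧ ν.real F < ν.real E)
    (A : Set Ω) (hA : MeasurableSet A) :
    ∃ D : ℝ → Set Ω,
      (∀ t, 0 ≤ t → t ≤ ν.real A → MeasurableSet (D t) ∧ D t ⊆ A ∧ ν.real (D t) = t) ∧
      (∀ s t, 0 ≤ s → s ≤ t → t ≤ ν.real A → D s ⊆ D t) := by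
  let r : {B : Set Ω // MeasurableSet B ∧ B ⊆ A} → {B : Set Ω // MeasurableSet B ∧ B ⊆ A} → Prop :=
    fun B C => B.1 ⊆ C.1 ∧ ν.real B.1 < ν.real C.1
  obtain ⟨C, hC⟩ : ∃ C, IsMaxChain r C := ⟨_, maxChain_spec⟩
  have hmax : ∀ B, (∀ D ∈ C, r B D ∨ r D B) → B ∈ C := by
    intro B hB
    have h := hC.2 (hC.1.insert (a := B) fun D hD _ => hB D hD) (Set.subset_insert _ _)
    rw [h]; exact Set.mem_insert _ _
  have hlt : ∀ B ∈ C, ∀ D ∈ C, ν.real B.1 < ν.real D.1 → B.1 ⊆ D.1 := by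
    intro B hB D hD h
    have hne : B ≠ D := by rintro rfl; exact lt_irrefl _ h
    rcases hC.1 hB hD hne with h1 | h1
    · exact h1.1
    · exact absurd h1.2 (not_lt.2 h.le)
  have heq : ∀ B ∈ C, ∀ D ∈ C, ν.real B.1 = ν.real D.1 → B = D := by
    intro B hB D hD h
    by_contra hne
    rcases hC.1 hB hD hne with h1 | h1
    · exact h1.2.ne h
    · exact h1.2.ne h.symm
  have hle : ∀ B ∈ C, ∀ D ∈ C, ν.real B.1 ≤ ν.real D.1 → B.1 ⊆ D.1 := by
    intro B hB D hD h
    rcases h.lt_or_eq with h | h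
    · exact hlt B hB D hD h
    · rw [heq B hB D hD h]
  have hleA : ∀ B : {B : Set Ω // MeasurableSet B ∧ B ⊆ A}, ν.real B.1 ≤ ν.real A :=
    fun B => measureReal_mono B.2.2
  have hbot : ∃ B ∈ C, ν.real B.1 = 0 := by
    by_contra hcon
    push Not at hcon
    refine hcon ⟨∅, MeasurableSet.empty, Set.empty_subset _⟩ (hmax _ fun D hD => Or.inl ?_) (by simp)
    refine ⟨Set.empty_subset _, ?_⟩
    simpa using lt_of_le_of_ne measureReal_nonneg (hcon D hD).symm
  have htop : ∃ B ∈ C, ν.real B.1 = ν.real A := by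
    by_contra hcon
    push Not at hcon
    refine hcon ⟨A, hA, subset_rfl⟩ (hmax _ fun D hD => Or.inr ?_) rfl
    exact ⟨D.2.2, lt_of_le_of_ne (hleA D) (hcon D hD)⟩
  have key : ∀ t, 0 ≤ t → t ≤ ν.real A → ∃ B ∈ C, ν.real B.1 = t := by
    intro t ht0 htA
    -- the largest element below `t`
    have hL : ∃ L ∈ C, ν.real L.1 ≤ t ∧ ∀ D ∈ C, ν.real D.1 ≤ t → ν.real D.1 ≤ ν.real L.1 := by
      by_contra hcon
      push Not at hcon
      let S : Set ℝ := (fun B => ν.real B.1) '' {B | B ∈ C ∧ ν.real B.1 ≤ t}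
      have hS : S.Nonempty := by
        obtain ⟨B, hB, h0⟩ := hbot
        exact ⟨_, B, ⟨hB, by rw [h0]; exact ht0⟩, rfl⟩
      have hSb : BddAbove S := ⟨t, by rintro _ ⟨B, hB, rfl⟩; exact hB.2⟩
      obtain ⟨w, hwm, hwt, hwS⟩ := exists_seq_tendsto_sSup hS hSb
      choose L hL hLw using hwS
      simp only at hLw
      have hmono : Monotone (fun n => (L n).1) := by
        intro m n hmn
        exact hle _ (hL m).1 _ (hL n).1 (by rw [hLw, hLw]; exact hwm hmn)
      have hlim : ν.real (⋃ n, (L n).1) = sSup S := by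
        have h1 := tendsto_measure_iUnion_atTop (μ := ν) hmono
        have h2 := (ENNReal.tendsto_toReal (measure_ne_top ν _)).comp h1
        refine tendsto_nhds_unique h2 ?_
        convert hwt using 1
        funext n
        exact hLw n
      have hstrict : ∀ D ∈ C, ν.real D.1 ≤ t → ν.real D.1 < sSup S := by
        intro D hD hDt
        obtain ⟨D', hD', h1, h2⟩ := hcon D hD hDt
        exact h2.trans_le (le_csSup hSb ⟨D', ⟨hD', h1⟩, rfl⟩)
      have hst : sSup S ≤ t := csSup_le hS (by rintro _ ⟨B, hB, rfl⟩; exact hB.2)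
      let U : {B : Set Ω // MeasurableSet B ∧ B ⊆ A} :=
        ⟨⋃ n, (L n).1, MeasurableSet.iUnion fun n => (L n).2.1, Set.iUnion_subset fun n => (L n).2.2⟩
      have hU : U ∈ C := by
        refine hmax U fun D hD => ?_
        rcases le_or_gt (ν.real D.1) t with h | h
        · right
          have h1 := hstrict D hD h
          obtain ⟨n, hn⟩ := (hwt.eventually (lt_mem_nhds h1)).exists
          refine ⟨(hlt D hD _ (hL n).1 (by rw [hLw]; exact hn)).trans
            (Set.subset_iUnion (fun n => (L n).1) n), ?_⟩
          change _ < ν.real (⋃ n, (L n).1)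
          rw [hlim]; exact h1
        · left
          refine ⟨Set.iUnion_subset fun n => hlt _ (hL n).1 _ hD ((hL n).2.trans_lt h), ?_⟩
          change ν.real (⋃ n, (L n).1) < _
          rw [hlim]; exact hst.trans_lt h
      have hUt : ν.real U.1 ≤ t := by
        change ν.real (⋃ n, (L n).1) ≤ _
        rw [hlim]; exact hst
      have := hstrict U hU hUt
      change ν.real (⋃ n, (L n).1) < _ at this
      rw [hlim] at this
      exact lt_irrefl _ this
    have hR : ∃ L ∈ C, t ≤ ν.real L.1 ∧ ∀ D ∈ C, t ≤ ν.real D.1 → ν.real L.1 ≤ ν.real D.1 := by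
      by_contra hcon
      push Not at hcon
      let S : Set ℝ := (fun B => ν.real B.1) '' {B | B ∈ C ∧ t ≤ ν.real B.1}
      have hS : S.Nonempty := by
        obtain ⟨B, hB, h0⟩ := htop
        exact ⟨_, B, ⟨hB, by rw [h0]; exact htA⟩, rfl⟩
      have hSb : BddBelow S := ⟨t, by rintro _ ⟨B, hB, rfl⟩; exact hB.2⟩
      obtain ⟨w, hwm, hwt, hwS⟩ := exists_seq_tendsto_sInf hS hSb
      choose L hL hLw using hwS
      simp only at hLw
      have hmono : Antitone (fun n => (L n).1) := by
        intro m n hmn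
        exact hle _ (hL n).1 _ (hL m).1 (by rw [hLw, hLw]; exact hwm hmn)
      have hlim : ν.real (⋂ n, (L n).1) = sInf S := by
        have h1 := tendsto_measure_iInter_atTop (μ := ν)
          (fun n => (L n).2.1.nullMeasurableSet) hmono ⟨0, measure_ne_top ν _⟩
        have h2 := (ENNReal.tendsto_toReal (measure_ne_top ν _)).comp h1
        refine tendsto_nhds_unique h2 ?_
        convert hwt using 1
        funext n
        exact hLw n
      have hstrict : ∀ D ∈ C, t ≤ ν.real D.1 → sInf S < ν.real D.1 := by
        intro D hD hDt
        obtain ⟨D', hD', h1, h2⟩ := hcon D hD hDt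
        exact (csInf_le hSb ⟨D', ⟨hD', h1⟩, rfl⟩).trans_lt h2
      have hst : t ≤ sInf S := le_csInf hS (by rintro _ ⟨B, hB, rfl⟩; exact hB.2)
      let U : {B : Set Ω // MeasurableSet B ∧ B ⊆ A} :=
        ⟨⋂ n, (L n).1, MeasurableSet.iInter fun n => (L n).2.1,
          (Set.iInter_subset _ 0).trans (L 0).2.2⟩
      have hU : U ∈ C := by
        refine hmax U fun D hD => ?_
        rcases le_or_gt t (ν.real D.1) with h | h
        · left
          have h1 := hstrict D hD h
          obtain ⟨n, hn⟩ := (hwt.eventually (gt_mem_nhds h1)).exists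
          refine ⟨(Set.iInter_subset (fun n => (L n).1) n).trans
            (hlt _ (hL n).1 D hD (by rw [hLw]; exact hn)), ?_⟩
          change ν.real (⋂ n, (L n).1) < _
          rw [hlim]; exact h1
        · right
          refine ⟨Set.subset_iInter fun n => hlt _ hD _ (hL n).1 (h.trans_le (hL n).2), ?_⟩
          change _ < ν.real (⋂ n, (L n).1)
          rw [hlim]; exact h.trans_le hst
      have hUt : t ≤ ν.real U.1 := by
        change _ ≤ ν.real (⋂ n, (L n).1)
        rw [hlim]; exact hst
      have := hstrict U hU hUt
      change _ < ν.real (⋂ n, (L n).1) at this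
      rw [hlim] at this
      exact lt_irrefl _ this
    obtain ⟨L, hLC, hLt, hLm⟩ := hL
    obtain ⟨R, hRC, hRt, hRm⟩ := hR
    by_contra hcon
    push Not at hcon
    have hLt' := lt_of_le_of_ne hLt (hcon L hLC)
    have hRt' := lt_of_le_of_ne hRt (hcon R hRC).symm
    have hLR := hlt L hLC R hRC (hLt'.trans hRt')
    have hdiff : ν.real (R.1 \ L.1) = ν.real R.1 - ν.real L.1 := measureReal_sdiff hLR L.2.1
    obtain ⟨F, hFm, hFs, hF0, hF1⟩ := hna (R.1 \ L.1) (R.2.1.diff L.2.1) (by rw [hdiff]; linarith)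
    have hun : ν.real (L.1 ∪ F) = ν.real L.1 + ν.real F :=
      measureReal_union (Set.disjoint_left.2 fun x hx hx' => (hFs hx').2 hx) hFm
    let G : {B : Set Ω // MeasurableSet B ∧ B ⊆ A} :=
      ⟨L.1 ∪ F, L.2.1.union hFm, Set.union_subset L.2.2 (fun x hx => R.2.2 (hFs hx).1)⟩
    have hGv : ν.real G.1 = ν.real L.1 + ν.real F := hun
    have hG : G ∈ C := by
      refine hmax G fun D hD => ?_
      rcases le_total (ν.real D.1) t with h | h
      · right
        have h1 := hLm D hD h
        exact ⟨(hle D hD L hLC h1).trans Set.subset_union_left, by rw [hGv]; linarith⟩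
      · left
        have h1 := hRm D hD h
        refine ⟨(Set.union_subset hLR (fun x hx => (hFs hx).1)).trans (hle R hRC D hD h1), ?_⟩
        rw [hGv]; linarith
    rcases le_total (ν.real G.1) t with h | h
    · have := hLm G hG h
      linarith
    · have := hRm G hG h
      linarith
  have : Nonempty {B : Set Ω // MeasurableSet B ∧ B ⊆ A} := ⟨⟨A, hA, subset_rfl⟩⟩
  choose! D hD hDt using key
  refine ⟨fun t => (D t).1, fun t h0 h1 => ⟨(D t).2.1, (D t).2.2, hDt t h0 h1⟩, ?_⟩
  intro s t hs hst ht
  refine hle _ (hD s hs (hst.trans ht)) _ (hD t (hs.trans hst) ht) ?_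
  rw [hDt s hs (hst.trans ht), hDt t (hs.trans hst) ht]
  exact hst

/-- Two-dimensional halving. -/
lemma exists_half_aux (π₀ π₁ : Measure Ω) (h₀ : IsBelief π₀) (h₁ : IsBelief π₁)
    (A : Set Ω) (hA : MeasurableSet A) :
    ∃ H, MeasurableSet H ∧ H ⊆ A ∧ π₀.real H = π₀.real A / 2 ∧ π₁.real H = π₁.real A / 2 := by
  have := h₀.1
  have := h₁.1
  have hadd : ∀ E, (π₀ + π₁).real E = π₀.real E + π₁.real E := fun E => measureReal_add_apply
  have hpos : ∀ (π : Measure Ω), IsBelief π → ∀ E, MeasurableSet E → 0 < π.real E →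
      ∃ F, MeasurableSet F ∧ F ⊆ E ∧ 0 < π.real F ∧ π.real F < π.real E := by
    intro π hπ E hE h
    have := hπ.1
    obtain ⟨F, hF, hFE, h1, h2⟩ := hπ.2 E hE (by
      rw [pos_iff_ne_zero]; intro h'; simp [Measure.real, h'] at h)
    refine ⟨F, hF, hFE, ENNReal.toReal_pos h1.ne' (measure_ne_top _ _), ?_⟩
    exact (ENNReal.toReal_lt_toReal (measure_ne_top _ _) (measure_ne_top _ _)).2 h2
  have hna : ∀ E, MeasurableSet E → 0 < (π₀ + π₁).real E →
      ∃ F, MeasurableSet F ∧ F ⊆ E ∧ 0 < (π₀ + π₁).real F ∧ (π₀ + π₁).real F < (π₀ + π₁).real E := by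
    intro E hE h
    simp only [hadd] at h ⊢
    by_cases hz : 0 < π₀.real E
    · obtain ⟨F, hF, hFE, h1, h2⟩ := hpos π₀ h₀ E hE hz
      have h3 : 0 ≤ π₁.real F := measureReal_nonneg
      have h4 : π₁.real F ≤ π₁.real E := measureReal_mono hFE
      exact ⟨F, hF, hFE, by linarith, by linarith⟩
    · obtain ⟨F, hF, hFE, h1, h2⟩ := hpos π₁ h₁ E hE (by linarith)
      have h3 : 0 ≤ π₀.real F := measureReal_nonneg
      have h4 : π₀.real F ≤ π₀.real E := measureReal_mono hFE
      exact ⟨F, hF, hFE, by linarith, by linarith⟩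
  obtain ⟨D, hD, hDm⟩ := exists_chain_aux (π₀ + π₁) hna A hA
  set M := (π₀ + π₁).real A with hM
  have hM0 : 0 ≤ M := measureReal_nonneg
  have hdiff : ∀ (π : Measure Ω) [IsFiniteMeasure π], ∀ s t, 0 ≤ s → s ≤ t → t ≤ M →
      π.real (D t \ D s) = π.real (D t) - π.real (D s) := by
    intro π _ s t hs hst ht
    exact measureReal_sdiff (hDm s t hs hst ht) (hD s hs (hst.trans ht)).1
  have hlip : ∀ s t, 0 ≤ s → s ≤ t → t ≤ M →
      0 ≤ π₀.real (D t) - π₀.real (D s) ∧ π₀.real (D t) - π₀.real (D s) ≤ t - s := by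
    intro s t hs hst ht
    have e1 := hdiff (π₀ + π₁) s t hs hst ht
    rw [(hD t (hs.trans hst) ht).2.2, (hD s hs (hst.trans ht)).2.2, hadd] at e1
    have e2 := hdiff π₀ s t hs hst ht
    have e3 : 0 ≤ π₁.real (D t \ D s) := measureReal_nonneg
    have e4 : 0 ≤ π₀.real (D t \ D s) := measureReal_nonneg
    constructor <;> linarith
  have hcont : ContinuousOn (fun t => π₀.real (D t)) (Set.Icc 0 M) := by
    have : LipschitzOnWith 1 (fun t => π₀.real (D t)) (Set.Icc 0 M) := by
      refine LipschitzOnWith.of_dist_le_mul fun s hs t ht => ?_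
      simp only [Real.dist_eq, NNReal.coe_one, one_mul]
      rcases le_total s t with h | h
      · have := hlip s t hs.1 h ht.2
        rw [abs_sub_comm, abs_sub_comm s t, abs_of_nonneg this.1, abs_of_nonneg (by linarith)]
        exact this.2
      · have := hlip t s ht.1 h hs.2
        rw [abs_of_nonneg this.1, abs_of_nonneg (by linarith)]
        exact this.2
    exact this.continuousOn
  let g : ℝ → ℝ := fun t => π₀.real (D (t + M / 2)) - π₀.real (D t)
  have hg : ContinuousOn g (Set.Icc 0 (M / 2)) := by
    refine ContinuousOn.sub (hcont.comp (by fun_prop) ?_) (hcont.mono ?_)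
    · intro t ht; exact ⟨by linarith [ht.1], by linarith [ht.2]⟩
    · intro t ht; exact ⟨ht.1, by linarith [ht.2]⟩
  have hD0 : π₀.real (D 0) = 0 := by
    have e := (hD 0 le_rfl hM0).2.2
    rw [hadd] at e
    have e3 : 0 ≤ π₁.real (D 0) := measureReal_nonneg
    have e4 : 0 ≤ π₀.real (D 0) := measureReal_nonneg
    linarith
  have hDM : π₀.real (D M) = π₀.real A := by
    obtain ⟨_, hs, e⟩ := hD M hM0 le_rfl
    rw [hadd] at e
    have e3 : π₁.real (D M) ≤ π₁.real A := measureReal_mono hs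
    have e4 : π₀.real (D M) ≤ π₀.real A := measureReal_mono hs
    have := hadd A
    linarith
  have hsum : g 0 + g (M / 2) = π₀.real A := by
    simp only [g, zero_add, add_halves, hDM, hD0]
    ring
  have hivt : ∃ t ∈ Set.Icc 0 (M / 2), g t = π₀.real A / 2 := by
    have hle : (0 : ℝ) ≤ M / 2 := by linarith
    rcases le_total (g 0) (g (M / 2)) with h | h
    · exact intermediate_value_Icc hle hg ⟨by linarith, by linarith⟩
    · exact intermediate_value_Icc' hle hg ⟨by linarith, by linarith⟩
  obtain ⟨t, ht, hgt⟩ := hivt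
  have hb : t ≤ t + M / 2 := by linarith
  have hb' : t + M / 2 ≤ M := by linarith [ht.2]
  have e1 := hdiff (π₀ + π₁) t (t + M / 2) ht.1 hb hb'
  have e2 := hdiff π₀ t (t + M / 2) ht.1 hb hb'
  rw [(hD t ht.1 (by linarith)).2.2, (hD (t + M / 2) (by linarith [ht.1]) hb').2.2, hadd] at e1
  refine ⟨D (t + M / 2) \ D t, (hD _ (by linarith [ht.1]) hb').1.diff (hD t ht.1 (by linarith)).1,
    fun x hx => (hD _ (by linarith [ht.1]) hb').2.1 hx.1, ?_, ?_⟩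
  · rw [e2]; exact hgt
  · have := hadd A
    have h3 : π₀.real (D (t + M / 2)) - π₀.real (D t) = π₀.real A / 2 := hgt
    linarith

/-- From halving to arbitrary fractions. -/
lemma exists_frac_aux {κ : Type*} (μ : κ → Measure Ω) [∀ k, IsFiniteMeasure (μ k)]
    (hhalf : ∀ A, MeasurableSet A →
      ∃ H, MeasurableSet H ∧ H ⊆ A ∧ ∀ k, (μ k).real H = (μ k).real A / 2)
    (A : Set Ω) (hA : MeasurableSet A) (c : ℝ) (hc0 : 0 ≤ c) (hc1 : c ≤ 1) :
    ∃ E, MeasurableSet E ∧ E ⊆ A ∧ ∀ k, (μ k).real E = c * (μ k).real A := by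
  let P : ℕ → Set Ω × Set Ω × ℝ → Prop := fun n x =>
    MeasurableSet x.1 ∧ MeasurableSet x.2.1 ∧ x.1 ⊆ x.2.1 ∧ x.2.1 ⊆ A ∧
    (∀ k, (μ k).real x.1 = x.2.2 * (μ k).real A) ∧
    (∀ k, (μ k).real x.2.1 = (x.2.2 + (1 / 2) ^ n) * (μ k).real A) ∧
    x.2.2 ≤ c ∧ c ≤ x.2.2 + (1 / 2) ^ n
  have hstep : ∀ n x, P n x → ∃ y, P (n + 1) y ∧ x.1 ⊆ y.1 := by
    rintro n ⟨L, U, l⟩ ⟨hL, hU, hLU, hUA, h1, h2, h3, h4⟩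
    dsimp only at *
    obtain ⟨H, hH, hHs, hHk⟩ := hhalf (U \ L) (hU.diff hL)
    have hun : ∀ k, (μ k).real (L ∪ H) = (l + (1 / 2) ^ (n + 1)) * (μ k).real A := by
      intro k
      rw [measureReal_union (Set.disjoint_left.2 fun x hx hx' => (hHs hx').2 hx) hH, hHk,
        measureReal_sdiff hLU hL, h1, h2, pow_succ]
      ring
    have hLH : L ∪ H ⊆ U := Set.union_subset hLU fun x hx => (hHs hx).1
    have hp : ((1 : ℝ) / 2) ^ (n + 1) + (1 / 2) ^ (n + 1) = (1 / 2) ^ n := by rw [pow_succ]; ring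
    rcases le_total c (l + (1 / 2) ^ (n + 1)) with h | h
    · exact ⟨(L, L ∪ H, l), ⟨hL, hL.union hH, Set.subset_union_left, hLH.trans hUA, h1, hun, h3, h⟩,
        subset_rfl⟩
    · refine ⟨(L ∪ H, U, l + (1 / 2) ^ (n + 1)), ⟨hL.union hH, hU, hLH, hUA, hun, ?_, h, ?_⟩,
        Set.subset_union_left⟩
      · intro k
        dsimp only
        rw [h2, add_assoc, hp]
      · dsimp only
        rw [add_assoc, hp]; exact h4
  choose! nxt hnxt hnxts using hstep
  let q : ℕ → Set Ω × Set Ω × ℝ := fun n => Nat.rec (∅, A, 0) (fun n x => nxt n x) n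
  have hq : ∀ n, P n (q n) := by
    intro n
    induction n with
    | zero =>
      refine ⟨MeasurableSet.empty, hA, Set.empty_subset _, subset_rfl, ?_, ?_, hc0, ?_⟩
      · intro k; simp [q]
      · intro k; simp [q]
      · simpa [q] using hc1
    | succ n ih => exact hnxt n _ ih
  have hmono : Monotone (fun n => (q n).1) := monotone_nat_of_le_succ fun n => hnxts n _ (hq n)
  refine ⟨⋃ n, (q n).1, MeasurableSet.iUnion fun n => (hq n).1,
    Set.iUnion_subset fun n => (hq n).2.2.1.trans (hq n).2.2.2.1, fun k => ?_⟩
  have hl : Tendsto (fun n => (q n).2.2) atTop (𝓝 c) := by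
    have h0 : Tendsto (fun n : ℕ => c - ((1 : ℝ) / 2) ^ n) atTop (𝓝 c) := by
      simpa using tendsto_const_nhds.sub
        (tendsto_pow_atTop_nhds_zero_of_lt_one (r := (1 : ℝ) / 2) (by norm_num) (by norm_num))
    refine tendsto_of_tendsto_of_tendsto_of_le_of_le h0 tendsto_const_nhds ?_ ?_
    · intro n
      have := (hq n).2.2.2.2.2.2.2
      dsimp only
      linarith
    · intro n
      exact (hq n).2.2.2.2.2.2.1
  have h1 := tendsto_measure_iUnion_atTop (μ := μ k) hmono
  have h2 := (ENNReal.tendsto_toReal (measure_ne_top (μ k) _)).comp h1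
  refine tendsto_nhds_unique h2 ?_
  convert hl.mul_const ((μ k).real A) using 1
  funext n
  exact (hq n).2.2.2.2.1 k

/-- If the value of `π` on events on which `π₀` and `π₁` agree is determined by the common value,
then `π` lies on the affine line through `π₀` and `π₁`. -/
lemma affine_aux (π₀ π₁ π : Measure Ω) (h₀ : IsBelief π₀) (h₁ : IsBelief π₁)
    (hπ : IsProbabilityMeasure π)
    (hdet : ∀ E F, MeasurableSet E → MeasurableSet F → π₀.real E = π₁.real E →
      π₀.real F = π₁.real F → π₀.real E = π₀.real F → π.real E = π.real F) :
    ∃ α : ℝ, (∀ E, MeasurableSet E → π.real E = (1 - α) * π₀.real E + α * π₁.real E) ∧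
      (π₀ = π₁ → α = 0) := by
  have := h₀.1
  have := h₁.1
  have hhalf : ∀ A, MeasurableSet A → ∃ H, MeasurableSet H ∧ H ⊆ A ∧ π₀.real H = π₀.real A / 2 ∧
      π₁.real H = π₁.real A / 2 ∧ π.real H = π.real A / 2 := by
    intro A hA
    obtain ⟨H, hH, hHA, e0, e1⟩ := exists_half_aux π₀ π₁ h₀ h₁ A hA
    obtain ⟨K, hK, hKA, k0, k1⟩ := exists_half_aux π₀ π₁ h₀ h₁ Aᶜ hA.compl
    refine ⟨H, hH, hHA, e0, e1, ?_⟩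
    have d1 : Disjoint H K := Set.disjoint_left.2 fun x hx hx' => hKA hx' (hHA hx)
    have d2 : Disjoint (A \ H) K := Set.disjoint_left.2 fun x hx hx' => hKA hx' hx.1
    have c0 := probReal_compl_eq_one_sub (μ := π₀) hA
    have c1 := probReal_compl_eq_one_sub (μ := π₁) hA
    have s0 := measureReal_sdiff (μ := π₀) hHA hH
    have s1 := measureReal_sdiff (μ := π₁) hHA hH
    have s := measureReal_sdiff (μ := π) hHA hH
    have key := hdet (H ∪ K) ((A \ H) ∪ K) (hH.union hK) ((hA.diff hH).union hK)
      (by rw [measureReal_union d1 hK, measureReal_union d1 hK]; linarith)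
      (by rw [measureReal_union d2 hK, measureReal_union d2 hK]; linarith)
      (by rw [measureReal_union d1 hK, measureReal_union d2 hK]; linarith)
    rw [measureReal_union d1 hK, measureReal_union d2 hK] at key
    linarith
  have hfrac : ∀ A, MeasurableSet A → ∀ c : ℝ, 0 ≤ c → c ≤ 1 → ∃ E, MeasurableSet E ∧ E ⊆ A ∧
      π₀.real E = c * π₀.real A ∧ π₁.real E = c * π₁.real A ∧ π.real E = c * π.real A := by
    intro A hA c hc0 hc1
    have inst : ∀ k, IsFiniteMeasure ((![π₀, π₁, π] : Fin 3 → Measure Ω) k) := by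
      intro k; fin_cases k <;> simp <;> infer_instance
    obtain ⟨E, hE, hEA, h⟩ := exists_frac_aux (![π₀, π₁, π] : Fin 3 → Measure Ω) (by
      intro A hA
      obtain ⟨H, hH, hHA, e0, e1, e⟩ := hhalf A hA
      refine ⟨H, hH, hHA, fun k => ?_⟩
      fin_cases k
      · exact e0
      · exact e1
      · exact e) A hA c hc0 hc1
    exact ⟨E, hE, hEA, h 0, h 1, h 2⟩
  have hdiag : ∀ A, MeasurableSet A → π₀.real A = π₁.real A → π.real A = π₀.real A := by
    intro A hA h
    obtain ⟨E, hE, -, e0, e1, e⟩ := hfrac Set.univ MeasurableSet.univ (π₀.real A) measureReal_nonneg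
      measureReal_le_one
    simp only [probReal_univ, mul_one] at e0 e1 e
    rw [hdet A E hA hE h (by linarith) e0.symm, e]
  by_cases heq : π₀ = π₁
  · subst heq
    exact ⟨0, fun E hE => by rw [hdiag E hE rfl]; ring, fun _ => rfl⟩
  obtain ⟨B, hB, hBne⟩ : ∃ B, MeasurableSet B ∧ π₀.real B ≠ π₁.real B := by
    by_contra hcon
    push Not at hcon
    refine heq (Measure.ext fun E hE => ?_)
    exact (ENNReal.toReal_eq_toReal_iff' (measure_ne_top _ _) (measure_ne_top _ _)).1 (hcon E hE)
  -- same-sign subsets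
  have hsame : ∀ B, MeasurableSet B → ∀ A, MeasurableSet A → A ⊆ B →
      0 < (π₁.real A - π₀.real A) * (π₁.real B - π₀.real B) →
      (π.real A - π₀.real A) * (π₁.real B - π₀.real B) =
        (π.real B - π₀.real B) * (π₁.real A - π₀.real A) := by
    intro B hB A hA hAB hpos
    have c0 := probReal_compl_eq_one_sub (μ := π₀) hB
    have c1 := probReal_compl_eq_one_sub (μ := π₁) hB
    have c := probReal_compl_eq_one_sub (μ := π) hB
    set dA := π₁.real A - π₀.real A with hdA
    set dB := π₁.real B - π₀.real B with hdB
    have hs : dA + dB ≠ 0 := by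
      intro h
      have : dA = -dB := by linarith
      rw [this] at hpos
      nlinarith [sq_nonneg dB]
    have hs2 : 0 < (dA + dB) ^ 2 := by positivity
    have ha0 : 0 ≤ dB / (dA + dB) := by
      have : dB / (dA + dB) = (dA * dB + dB ^ 2) / (dA + dB) ^ 2 := by field_simp
      rw [this]; positivity
    have hb0 : 0 ≤ dA / (dA + dB) := by
      have : dA / (dA + dB) = (dA * dB + dA ^ 2) / (dA + dB) ^ 2 := by field_simp; ring
      rw [this]; positivity
    have hab : dB / (dA + dB) + dA / (dA + dB) = 1 := by field_simp; ring
    obtain ⟨E, hE, hEA, e0, e1, e⟩ := hfrac A hA (dB / (dA + dB)) ha0 (by linarith)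
    obtain ⟨F, hF, hFB, f0, f1, f⟩ := hfrac Bᶜ hB.compl (dA / (dA + dB)) hb0 (by linarith)
    have hd : Disjoint E F := Set.disjoint_left.2 fun x hx hx' => hFB hx' (hAB (hEA hx))
    have hz : dB / (dA + dB) * dA = dA / (dA + dB) * dB := by ring
    have key := hdiag (E ∪ F) (hE.union hF) (by
      rw [measureReal_union hd hF, measureReal_union hd hF, e0, e1, f0, f1, c0, c1]
      have h1 : π₁.real A = π₀.real A + dA := by rw [hdA]; ring
      have h2 : π₁.real B = π₀.real B + dB := by rw [hdB]; ring
      rw [h1, h2]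
      linear_combination -hz)
    rw [measureReal_union hd hF, measureReal_union hd hF, e0, e, f0, f, c0, c] at key
    field_simp at key
    linear_combination key
  have hsub : ∀ B, MeasurableSet B → π₁.real B - π₀.real B ≠ 0 → ∀ A, MeasurableSet A → A ⊆ B →
      (π.real A - π₀.real A) * (π₁.real B - π₀.real B) =
        (π.real B - π₀.real B) * (π₁.real A - π₀.real A) := by
    intro B hB hne A hA hAB
    rcases lt_trichotomy ((π₁.real A - π₀.real A) * (π₁.real B - π₀.real B)) 0 with h | h | h
    · have s0 := measureReal_sdiff (μ := π₀) hAB hA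
      have s1 := measureReal_sdiff (μ := π₁) hAB hA
      have s := measureReal_sdiff (μ := π) hAB hA
      have := hsame B hB (B \ A) (hB.diff hA) Set.sdiff_subset (by
        rw [s0, s1]
        have : 0 < (π₁.real B - π₀.real B) ^ 2 := by positivity
        nlinarith)
      rw [s0, s1, s] at this
      linear_combination -this
    · have h0 : π₁.real A - π₀.real A = 0 := by
        rcases mul_eq_zero.1 h with h | h
        · exact h
        · exact absurd h hne
      rw [hdiag A hA (by linarith), h0]; ring
    · exact hsame B hB A hA hAB h
  have hne : π₁.real B - π₀.real B ≠ 0 := fun h => hBne (by linarith)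
  refine ⟨(π.real B - π₀.real B) / (π₁.real B - π₀.real B), fun A hA => ?_, fun h => absurd h heq⟩
  have c0 := probReal_compl_eq_one_sub (μ := π₀) hB
  have c1 := probReal_compl_eq_one_sub (μ := π₁) hB
  have c := probReal_compl_eq_one_sub (μ := π) hB
  have k1 := hsub B hB hne (A ∩ B) (hA.inter hB) Set.inter_subset_right
  have k2 := hsub Bᶜ hB.compl (by rw [c0, c1]; intro h; apply hne; linarith) (A \ B) (hA.diff hB)
    (fun x hx => hx.2)
  have t0 := measureReal_inter_add_sdiff (μ := π₀) (s := A) hB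
  have t1 := measureReal_inter_add_sdiff (μ := π₁) (s := A) hB
  have t := measureReal_inter_add_sdiff (μ := π) (s := A) hB
  rw [c0, c1, c] at k2
  rw [← t0, ← t1, ← t]
  field_simp
  linear_combination k1 - k2

/-- The two-outcome act `x` on `E`, `y` off `E`. -/
lemma exists_bet_aux {O : Type*} [MeasurableSpace O] (x y : O) (E : Set Ω) (hE : MeasurableSet E) :
    ∃ f : Act Ω O,
      (∀ (π : Measure Ω) [IsProbabilityMeasure π] (u : O → ℝ),
        ev π u f = π.real E * u x + (1 - π.real E) * u y) ∧
      (∀ (π π' : Measure Ω) [IsProbabilityMeasure π] [IsProbabilityMeasure π'],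
        π.real E = π'.real E → Measure.map f.1 π = Measure.map f.1 π') := by
  classical
  have hmeas : Measurable (E.piecewise (fun _ => x) (fun _ => y)) :=
    Measurable.piecewise hE measurable_const measurable_const
  refine ⟨⟨E.piecewise (fun _ => x) (fun _ => y), hmeas⟩, ?_, ?_⟩
  · intro π _ u
    have h1 : (fun ω => u (E.piecewise (fun _ => x) (fun _ => y) ω)) =
        E.piecewise (fun _ => u x) (fun _ => u y) := by
      funext ω
      by_cases h : ω ∈ E <;> simp [h]
    unfold ev
    simp only [h1]
    rw [integral_piecewise hE (integrable_const _).integrableOn (integrable_const _).integrableOn]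
    simp [probReal_compl_eq_one_sub hE]
  · intro π π' _ _ h
    have hE' : π E = π' E :=
      (ENNReal.toReal_eq_toReal_iff' (measure_ne_top _ _) (measure_ne_top _ _)).1 h
    have hc : π Eᶜ = π' Eᶜ := by
      rw [prob_compl_eq_one_sub hE, prob_compl_eq_one_sub hE, hE']
    refine Measure.ext fun S hS => ?_
    rw [Measure.map_apply hmeas hS, Measure.map_apply hmeas hS]
    by_cases hx : x ∈ S <;> by_cases hy : y ∈ S
    · have : E.piecewise (fun _ => x) (fun _ => y) ⁻¹' S = Set.univ := by
        ext ω; by_cases h : ω ∈ E <;> simp [h, hx, hy]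
      rw [this]; simp
    · have : E.piecewise (fun _ => x) (fun _ => y) ⁻¹' S = E := by
        ext ω; by_cases h : ω ∈ E <;> simp [h, hx, hy]
      rw [this, hE']
    · have : E.piecewise (fun _ => x) (fun _ => y) ⁻¹' S = Eᶜ := by
        ext ω; by_cases h : ω ∈ E <;> simp [h, hx, hy]
      rw [this, hc]
    · have : E.piecewise (fun _ => x) (fun _ => y) ⁻¹' S = ∅ := by
        ext ω; by_cases h : ω ∈ E <;> simp [h, hx, hy]
      rw [this]; simp

/-- Complete indifference is represented by any belief. -/
lemma representsBelief_of_indiff {O : Type*} [MeasurableSpace O] (π : Measure Ω) (hπ : IsBelief π)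
    (r : Pref Ω O) (hr : CompletelyIndifferent r) : RepresentsBelief π r := by
  refine ⟨hπ, fun _ => 0, ⟨measurable_const, 0, by simp⟩, fun f g => ?_⟩
  simp [ev, hr f g]

end Helpers

theorem stmt0 {Ω O I : Type*} [mΩ : MeasurableSpace Ω] [mO : MeasurableSpace O]
    [Fintype I] (hO : 4 ≤ Cardinal.mk O) (hI : 3 ≤ Fintype.card I)
    (Φ : (I → Pref Ω O) → Pref Ω O)
    (hSWF : ∀ p : I → Pref Ω O, IsProfile p → IsSEU (Φ p))
    (hmono : RestrictedMonotonicity Φ)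
    (hnbi : NoBeliefImposition Φ)
    (i : I) (p : I → Pref Ω O) (hp : IsProfile p)
    (πi : Measure Ω) (hπi : RepresentsBelief πi (p i)) :
    ∃ (πp πsi : Measure Ω) (α : ℝ),
      RepresentsBelief πp (Φ p) ∧
      RepresentsBelief πsi (Φ (updIndiff p i)) ∧
      (∀ E : Set Ω, MeasurableSet E →
        (πp E).toReal = (1 - α) * (πsi E).toReal + α * (πi E).toReal) ∧
      (¬ CompletelyIndifferent (Φ (updIndiff p i)) → α ≠ 1) := by
  classical
  have hbi := hπi.1
  have hpu : IsProfile (updIndiff p i) := by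
    intro j
    by_cases h : j = i
    · obtain ⟨hb, u, hu, hr⟩ := representsBelief_of_indiff (O := O) πi hbi indiffRel
        (fun _ _ => trivial)
      exact ⟨πi, u, hb, hu, by simpa [updIndiff, h] using hr⟩
    · simpa [updIndiff, h] using hp j
  obtain ⟨π, u, hπ, hu, hrep⟩ := hSWF p hp
  obtain ⟨π₀, u₀, hπ₀, hu₀, hrep₀⟩ := hSWF _ hpu
  have hR : RepresentsBelief π (Φ p) := ⟨hπ, u, hu, hrep⟩
  have hR₀ : RepresentsBelief π₀ (Φ (updIndiff p i)) := ⟨hπ₀, u₀, hu₀, hrep₀⟩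
  by_cases hc0 : CompletelyIndifferent (Φ (updIndiff p i))
  · exact ⟨π, π, 0, hR, representsBelief_of_indiff π hπ _ hc0, fun E _ => by ring,
      fun h => absurd hc0 h⟩
  by_cases hc : CompletelyIndifferent (Φ p)
  · exact ⟨π₀, π₀, 0, representsBelief_of_indiff π₀ hπ₀ _ hc, hR₀, fun E _ => by ring,
      fun _ => by norm_num⟩
  by_cases hci : CompletelyIndifferent (p i)
  · have hupd : updIndiff p i = p := by
      funext j
      by_cases h : j = i
      · subst h
        funext f g
        simp [updIndiff, indiffRel, hci f g]
      · simp [updIndiff, h]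
    refine ⟨π, π, 0, hR, by rw [hupd]; exact hR, fun E _ => by ring, fun _ => by norm_num⟩
  have := hπ.1
  have := hπ₀.1
  have := hbi.1
  obtain ⟨x, y, hxy⟩ : ∃ x y, u x ≠ u y := by
    by_contra hcon
    push Not at hcon
    refine hc fun f g => (hrep f g).2 (le_of_eq ?_)
    unfold ev
    exact integral_congr_ae (Filter.Eventually.of_forall fun ω => hcon _ _)
  obtain ⟨-, ui, hui, hrepi⟩ := id hπi
  have hdet : ∀ E F, MeasurableSet E → MeasurableSet F → π₀.real E = πi.real E →
      π₀.real F = πi.real F → π₀.real E = π₀.real F → π.real E = π.real F := by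
    intro E F hE hF h1 h2 h3
    obtain ⟨f, hf, hfm⟩ := exists_bet_aux x y E hE
    obtain ⟨g, hg, hgm⟩ := exists_bet_aux x y F hF
    have a1 : Φ (updIndiff p i) f g := (hrep₀ f g).2 (by rw [hf, hg, h3])
    have a2 : Φ (updIndiff p i) g f := (hrep₀ g f).2 (by rw [hf, hg, h3])
    have h4 : πi.real E = πi.real F := by linarith
    have b1 : p i f g := (hrepi f g).2 (by rw [hf, hg, h4])
    have b2 : p i g f := (hrepi g f).2 (by rw [hf, hg, h4])
    have m1 := hfm π₀ πi h1
    have m2 := hgm π₀ πi h2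
    have k1 := (hrep f g).1 ((hmono i p hp π₀ πi hR₀ hπi f g a1 a2 m1 m2).1 b1)
    have k2 := (hrep g f).1 ((hmono i p hp π₀ πi hR₀ hπi g f a2 a1 m2 m1).1 b2)
    have k := le_antisymm k1 k2
    rw [hf, hg] at k
    have k' : (π.real E - π.real F) * (u x - u y) = 0 := by linear_combination -k
    rcases mul_eq_zero.1 k' with h | h
    · linarith
    · exact absurd (by linarith) hxy
  obtain ⟨α, hα, hα0⟩ := affine_aux π₀ πi π hπ₀ hbi hπ.1 hdet
  refine ⟨π, π₀, α, hR, hR₀, hα, fun _ h1 => ?_⟩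
  have hne : π₀ ≠ πi := fun h => by
    have := hα0 h
    linarith
  refine hnbi i p hp hc0 hc hci π₀ π πi hR₀ hR hπi hne (Measure.ext fun E hE => ?_)
  refine (ENNReal.toReal_eq_toReal_iff' (measure_ne_top _ _) (measure_ne_top _ _)).1 ?_
  have := hα E hE
  rw [h1] at this
  have h2 : π.real E = πi.real E := by linarith
  exact h2
end

section
/- Suppose the social welfare function Φ satisfies restricted monotonicity, faithfulness, and no belief imposition. Let p ∈ R̄^I be such that Φ(p) is not complete indifference. Then φ(p) = Σ_{i∈I_p} v_i π_i for some v ∈ ℝ^{I_p} with Σ_{i∈I_p} v_i = 1. Moreover, if the beliefs (π_i)_{i∈I_p} are affinely independent and the utility functions (u_i)_{i∈I_p} are linearly independent, then v_i ≠ 0 for every i ∈ I_p and v is unique. -/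
open MeasureTheory

lemma tendsto_real_iUnion {Ω : Type*} [MeasurableSpace Ω] (μ : Measure Ω) [IsFiniteMeasure μ]
    {s : ℕ → Set Ω} (hs : Monotone s) :
    Filter.Tendsto (fun n => μ.real (s n)) Filter.atTop (nhds (μ.real (⋃ n, s n))) := by
  have := tendsto_measure_iUnion_atTop (μ := μ) hs
  exact (ENNReal.tendsto_toReal (measure_ne_top μ _)).comp this

lemma small_pos_subset {Ω : Type*} [mΩ : MeasurableSpace Ω] (ν : Measure Ω) [IsFiniteMeasure ν]
    (hν : NonatomicOn ν mΩ) {A : Set Ω} (hA : MeasurableSet A) (hpos : 0 < ν.real A)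
    {ε : ℝ} (hε : 0 < ε) :
    ∃ F, MeasurableSet F ∧ F ⊆ A ∧ 0 < ν.real F ∧ ν.real F < ε := by
  have key : ∀ n : ℕ, ∃ F, MeasurableSet F ∧ F ⊆ A ∧ 0 < ν.real F ∧
      ν.real F ≤ ν.real A * (1 / 2) ^ n := by
    intro n
    induction n with
    | zero => exact ⟨A, hA, subset_rfl, hpos, by simp⟩
    | succ n ih =>
      obtain ⟨F, hF, hFA, hF0, hFle⟩ := ih
      obtain ⟨G, hG, hGF, hG0, hGlt⟩ := hν F hF ((ENNReal.toReal_pos_iff.1 hF0).1)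
      have h1 : 0 < ν.real G := ENNReal.toReal_pos hG0.ne' (measure_ne_top _ _)
      have h2 : ν.real G < ν.real F :=
        (ENNReal.toReal_lt_toReal (measure_ne_top _ _) (measure_ne_top _ _)).2 hGlt
      have h3 : ν.real (F \ G) = ν.real F - ν.real G := measureReal_sdiff hGF hG
      by_cases h : ν.real G ≤ ν.real F / 2
      · exact ⟨G, hG, hGF.trans hFA, h1, by rw [pow_succ]; linarith⟩
      · exact ⟨F \ G, hF.diff hG, Set.sdiff_subset.trans hFA, by linarith, by
          rw [pow_succ]; linarith⟩
  have ht : Filter.Tendsto (fun n : ℕ => ν.real A * (1 / 2 : ℝ) ^ n) Filter.atTop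
      (nhds (ν.real A * 0)) :=
    (tendsto_pow_atTop_nhds_zero_of_lt_one (by norm_num) (by norm_num)).const_mul _
  rw [mul_zero] at ht
  obtain ⟨n, hn⟩ := (ht.eventually (gt_mem_nhds hε)).exists
  obtain ⟨F, hF, hFA, h0, hle⟩ := key n
  exact ⟨F, hF, hFA, h0, hle.trans_lt hn⟩

lemma sierpinski {Ω : Type*} [mΩ : MeasurableSpace Ω] (ν : Measure Ω) [IsFiniteMeasure ν]
    (hν : NonatomicOn ν mΩ) {A : Set Ω} (hA : MeasurableSet A) {c : ℝ} (hc0 : 0 ≤ c)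
    (hc : c ≤ ν.real A) :
    ∃ E, MeasurableSet E ∧ E ⊆ A ∧ ν.real E = c := by
  let S := {E : Set Ω // MeasurableSet E ∧ E ⊆ A ∧ ν.real E ≤ c}
  have step : ∀ E : S, ∃ E' : S, E.1 ⊆ E'.1 ∧ ∀ G : S, E.1 ⊆ G.1 →
      ν.real G.1 - ν.real E.1 ≤ 2 * (ν.real E'.1 - ν.real E.1) := by
    intro E
    set T : Set ℝ := {x | ∃ G : S, E.1 ⊆ G.1 ∧ x = ν.real G.1 - ν.real E.1} with hT
    have hbdd : BddAbove T := by
      refine ⟨c, ?_⟩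
      rintro x ⟨G, -, rfl⟩
      have := G.2.2.2
      have : 0 ≤ ν.real E.1 := measureReal_nonneg
      linarith
    have h0 : (0 : ℝ) ∈ T := ⟨E, subset_rfl, by simp⟩
    have hle : ∀ G : S, E.1 ⊆ G.1 → ν.real G.1 - ν.real E.1 ≤ sSup T :=
      fun G hG => le_csSup hbdd ⟨G, hG, rfl⟩
    rcases (le_csSup hbdd h0).eq_or_lt with h | h
    · refine ⟨E, subset_rfl, fun G hG => ?_⟩
      have := hle G hG
      linarith
    · obtain ⟨x, ⟨G, hG, rfl⟩, hx⟩ := exists_lt_of_lt_csSup ⟨0, h0⟩ (half_lt_self h)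
      refine ⟨G, hG, fun G' hG' => ?_⟩
      have := hle G' hG'
      linarith
  choose nx hnx1 hnx2 using step
  let e : ℕ → S := fun n => Nat.rec ⟨∅, MeasurableSet.empty, by simp, by simpa using hc0⟩
    (fun _ E => nx E) n
  have he : ∀ n, e (n + 1) = nx (e n) := fun n => rfl
  have hmono : Monotone (fun n => (e n).1) := monotone_nat_of_le_succ fun n => by
    rw [he]; exact hnx1 _
  have hlim := tendsto_real_iUnion ν hmono
  set U := ⋃ n, (e n).1 with hU
  have hUm : MeasurableSet U := MeasurableSet.iUnion fun n => (e n).2.1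
  have hUA : U ⊆ A := Set.iUnion_subset fun n => (e n).2.2.1
  have hUc : ν.real U ≤ c := le_of_tendsto' hlim fun n => (e n).2.2.2
  refine ⟨U, hUm, hUA, hUc.antisymm ?_⟩
  by_contra! hlt
  have hd : ν.real (A \ U) = ν.real A - ν.real U := measureReal_sdiff hUA hUm
  obtain ⟨F, hF, hFA, hF0, hFlt⟩ := small_pos_subset ν hν (hA.diff hUm)
    (by rw [hd]; linarith) (sub_pos.2 hlt)
  have hFle : ∀ n, ν.real F ≤ 2 * (ν.real (e (n+1)).1 - ν.real (e n).1) := by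
    intro n
    have hsub : (e n).1 ⊆ U := Set.subset_iUnion (fun n => (e n).1) n
    have hdis : Disjoint (e n).1 F := by
      refine Set.disjoint_left.2 fun x hx hxF => (hFA hxF).2 (hsub hx)
    have hun : ν.real ((e n).1 ∪ F) = ν.real (e n).1 + ν.real F := measureReal_union hdis hF
    have hle : ν.real (e n).1 ≤ ν.real U := measureReal_mono hsub
    have := hnx2 (e n) ⟨(e n).1 ∪ F, (e n).2.1.union hF,
      Set.union_subset (e n).2.2.1 (fun x hx => (hFA hx).1), by rw [hun]; linarith⟩
      Set.subset_union_left
    rw [he]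
    simp only [hun] at this
    linarith
  have hlim2 : Filter.Tendsto (fun n => 2 * (ν.real (e (n+1)).1 - ν.real (e n).1)) Filter.atTop
      (nhds (2 * (ν.real U - ν.real U))) :=
    (((Filter.tendsto_add_atTop_iff_nat 1).2 hlim).sub hlim).const_mul 2
  have := ge_of_tendsto' hlim2 hFle
  linarith

/-- Simultaneous halving for a list of measures. -/
def Halving {Ω : Type*} [MeasurableSpace Ω] (L : List (Measure Ω)) : Prop :=
  ∀ A : Set Ω, MeasurableSet A → ∃ E, MeasurableSet E ∧ E ⊆ A ∧ ∀ μ ∈ L, μ.real E = μ.real A / 2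

lemma chain_of_halving {Ω : Type*} [MeasurableSpace Ω] (L : List (Measure Ω))
    (hL : ∀ μ ∈ L, IsFiniteMeasure μ) (H : Halving L) {A : Set Ω} (hA : MeasurableSet A) :
    ∃ E : ℝ → Set Ω, (∀ s t, 0 ≤ s → s ≤ t → E s ⊆ E t) ∧ (∀ t, MeasurableSet (E t)) ∧
      (∀ t, E t ⊆ A) ∧ ∀ t, 0 ≤ t → t ≤ 1 → ∀ μ ∈ L, μ.real (E t) = t * μ.real A := by
  choose! half hm hs hh using H
  let D : ℕ → ℕ → Set Ω := fun n => Nat.rec (fun j => if j = 0 then ∅ else A)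
    (fun _ D j => D (j / 2) ∪ if j % 2 = 0 then ∅ else half (D (j / 2 + 1) \ D (j / 2))) n
  have D0 : ∀ j, D 0 j = if j = 0 then ∅ else A := fun _ => rfl
  have DS : ∀ n j, D (n + 1) j = D n (j / 2) ∪
    if j % 2 = 0 then ∅ else half (D n (j / 2 + 1) \ D n (j / 2)) := fun _ _ => rfl
  have hDm : ∀ n j, MeasurableSet (D n j) := by
    intro n
    induction n with
    | zero => intro j; rw [D0]; split_ifs; exacts [MeasurableSet.empty, hA]
    | succ n ih =>
      intro j; rw [DS]
      refine (ih _).union ?_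
      split_ifs
      exacts [MeasurableSet.empty, hm _ ((ih _).diff (ih _))]
  have hDA : ∀ n j, D n j ⊆ A := by
    intro n
    induction n with
    | zero => intro j; rw [D0]; split_ifs <;> simp
    | succ n ih =>
      intro j; rw [DS]
      refine Set.union_subset (ih _) ?_
      split_ifs
      · simp
      · exact (hs _ ((hDm _ _).diff (hDm _ _))).trans (Set.sdiff_subset.trans (ih _))
  have hDmono : ∀ n j, D n j ⊆ D n (j + 1) := by
    intro n
    induction n with
    | zero => intro j; rw [D0, D0]; split_ifs <;> simp_all
    | succ n ih =>
      intro j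
      rw [DS n j, DS n (j+1)]
      rcases Nat.even_or_odd' j with ⟨k, rfl | rfl⟩
      · have h1 : (2 * k) / 2 = k := by omega
        have h2 : (2 * k + 1) / 2 = k := by omega
        have h3 : (2 * k) % 2 = 0 := by omega
        rw [h1, h2, h3]
        simp
      · have h1 : (2 * k + 1) / 2 = k := by omega
        have h2 : (2 * k + 1 + 1) / 2 = k + 1 := by omega
        have h3 : (2 * k + 1) % 2 = 1 := by omega
        rw [h1, h2, h3]
        refine Set.union_subset ((ih k).trans Set.subset_union_left) ?_
        simp only [one_ne_zero, if_false]
        exact ((hs _ ((hDm _ _).diff (hDm _ _))).trans Set.sdiff_subset).trans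
          Set.subset_union_left
  have hDmono' : ∀ n, Monotone (D n) := fun n => monotone_nat_of_le_succ (hDmono n)
  have hDv : ∀ μ ∈ L, ∀ n j, j ≤ 2 ^ n → μ.real (D n j) = j / 2 ^ n * μ.real A := by
    intro μ hμ n
    have := hL μ hμ
    induction n with
    | zero =>
      intro j hj
      have : j = 0 ∨ j = 1 := by simp at hj; omega
      rcases this with rfl | rfl <;> simp [D0]
    | succ n ih =>
      intro j hj
      rw [DS]
      rcases Nat.even_or_odd' j with ⟨k, rfl | rfl⟩
      · have h1 : (2 * k) / 2 = k := by omega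
        have h3 : (2 * k) % 2 = 0 := by omega
        rw [h1, h3, if_pos rfl, Set.union_empty, ih k (by rw [pow_succ] at hj; omega)]
        push_cast
        rw [pow_succ]
        field_simp
      · have h1 : (2 * k + 1) / 2 = k := by omega
        have h3 : (2 * k + 1) % 2 = 1 := by omega
        have hk : k + 1 ≤ 2 ^ n := by rw [pow_succ] at hj; omega
        have hmd := (hDm n (k+1)).diff (hDm n k)
        rw [h1, h3, if_neg one_ne_zero, measureReal_union _ (hm _ hmd), hh _ hmd μ hμ,
          measureReal_sdiff (hDmono n k) (hDm n k), ih k (by omega), ih (k+1) hk]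
        · push_cast
          rw [pow_succ]
          field_simp
          ring
        · exact Set.disjoint_left.2 fun x hx hx' => (hs _ hmd hx').2 hx
  refine ⟨fun t => ⋃ n : ℕ, D n ⌊t * 2 ^ n⌋₊, ?_, ?_, ?_, ?_⟩
  · intro s t h0 hst
    refine Set.iUnion_mono fun n => hDmono' n (Nat.floor_mono ?_)
    gcongr
  · exact fun t => MeasurableSet.iUnion fun n => hDm _ _
  · exact fun t => Set.iUnion_subset fun n => hDA _ _
  · intro t h0 h1 μ hμ
    have := hL μ hμ
    have hmono : Monotone (fun n : ℕ => D n ⌊t * 2 ^ n⌋₊) := by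
      refine monotone_nat_of_le_succ fun n => ?_
      have e1 : D n ⌊t * 2 ^ n⌋₊ = D (n+1) (2 * ⌊t * 2 ^ n⌋₊) := by
        rw [DS]; simp
      rw [e1]
      refine hDmono' (n+1) (Nat.le_floor ?_)
      push_cast
      have := Nat.floor_le (a := t * 2 ^ n) (by positivity)
      rw [pow_succ]; linarith
    have hlim := tendsto_real_iUnion μ hmono
    have hv : ∀ n : ℕ, μ.real (D n ⌊t * 2 ^ n⌋₊) = (⌊t * 2 ^ n⌋₊ : ℝ) / 2 ^ n * μ.real A := by
      intro n
      refine hDv μ hμ n _ ?_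
      refine Nat.floor_le_of_le ?_
      push_cast
      nlinarith [show (0:ℝ) < 2 ^ n by positivity]
    simp only [hv] at hlim
    have hlim2 : Filter.Tendsto (fun n : ℕ => (⌊t * 2 ^ n⌋₊ : ℝ) / 2 ^ n * μ.real A) Filter.atTop
        (nhds (t * μ.real A)) := by
      refine Filter.Tendsto.mul_const _ ?_
      exact (tendsto_nat_floor_mul_div_atTop h0).comp
        (tendsto_pow_atTop_atTop_of_one_lt (by norm_num : (1:ℝ) < 2))
    exact tendsto_nhds_unique hlim hlim2

lemma halving_cons {Ω : Type*} [MeasurableSpace Ω] (ν : Measure Ω) (L : List (Measure Ω))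
    (hν : ν ∈ L) (hL : ∀ μ ∈ L, IsFiniteMeasure μ) (H : Halving L)
    (μ : Measure Ω) [IsFiniteMeasure μ] (hμ : μ ≤ ν) : Halving (μ :: L) := by
  intro A hA
  have := hL ν hν
  obtain ⟨E, hmono, hEm, hEA, hE⟩ := chain_of_halving L hL H hA
  have hle : ∀ S : Set Ω, μ.real S ≤ ν.real S := fun S =>
    ENNReal.toReal_mono (measure_ne_top _ _) (hμ S)
  have hdiff : ∀ s t, 0 ≤ s → s ≤ t → t ≤ 1 →
      |μ.real (E t) - μ.real (E s)| ≤ ν.real A * |t - s| := by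
    intro s t h0 hst h1
    have e1 : μ.real (E t \ E s) = μ.real (E t) - μ.real (E s) :=
      measureReal_sdiff (hmono s t h0 hst) (hEm s)
    have e2 : ν.real (E t \ E s) = ν.real (E t) - ν.real (E s) :=
      measureReal_sdiff (hmono s t h0 hst) (hEm s)
    rw [← e1, abs_of_nonneg measureReal_nonneg, abs_of_nonneg (by linarith)]
    refine (hle _).trans ?_
    rw [e2, hE t (by linarith) h1 ν hν, hE s h0 (by linarith) ν hν]
    linarith
  have hcont : ContinuousOn (fun t => μ.real (E t)) (Set.Icc 0 1) := by
    refine LipschitzOnWith.continuousOn (K := (ν.real A).toNNReal) ?_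
    refine LipschitzOnWith.of_dist_le_mul ?_
    intro x hx y hy
    rw [Real.dist_eq, Real.dist_eq, Real.coe_toNNReal _ measureReal_nonneg]
    rcases le_total x y with h | h
    · rw [abs_sub_comm, abs_sub_comm x y]; exact hdiff x y hx.1 h hy.2
    · exact hdiff y x hy.1 h hx.2
  let φ : ℝ → ℝ := fun s => μ.real (E (s + 1/2)) - μ.real (E s)
  have hφ : ContinuousOn φ (Set.Icc 0 (1/2)) := by
    refine ContinuousOn.sub ?_ (hcont.mono (Set.Icc_subset_Icc_right (by norm_num)))
    refine hcont.comp (f := fun s : ℝ => s + 1/2) (by fun_prop) ?_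
    intro s hs
    exact ⟨by linarith [hs.1], by linarith [hs.2]⟩
  have hE0 : μ.real (E 0) = 0 := by
    have := hle (E 0)
    rw [hE 0 le_rfl zero_le_one ν hν, zero_mul] at this
    exact le_antisymm this measureReal_nonneg
  have hE1 : μ.real (E 1) = μ.real A := by
    have h1 := hle (A \ E 1)
    rw [measureReal_sdiff (hEA 1) (hEm 1), measureReal_sdiff (hEA 1) (hEm 1),
      hE 1 zero_le_one le_rfl ν hν] at h1
    have h2 : μ.real (E 1) ≤ μ.real A := measureReal_mono (hEA 1)
    linarith
  have hsum : φ 0 + φ (1/2) = μ.real A := by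
    simp only [φ, zero_add]
    norm_num
    rw [hE0, hE1]; ring
  obtain ⟨s, hs, hφs⟩ : ∃ s ∈ Set.Icc (0:ℝ) (1/2), φ s = μ.real A / 2 := by
    have hz : (0:ℝ) ∈ Set.Icc (0:ℝ) (1/2) := ⟨le_rfl, by norm_num⟩
    have hh : (1/2:ℝ) ∈ Set.Icc (0:ℝ) (1/2) := ⟨by norm_num, le_rfl⟩
    rcases le_total (φ 0) (μ.real A / 2) with h | h
    · exact isPreconnected_Icc.intermediate_value hz hh hφ ⟨h, by linarith⟩
    · exact isPreconnected_Icc.intermediate_value hh hz hφ ⟨by linarith, h⟩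
  have hsub := hmono s (s + 1/2) hs.1 (by linarith)
  refine ⟨E (s + 1/2) \ E s, (hEm _).diff (hEm _), Set.sdiff_subset.trans (hEA _), ?_⟩
  intro μ' hμ'
  rcases List.mem_cons.1 hμ' with rfl | h
  · rw [measureReal_sdiff hsub (hEm _)]; exact hφs
  · have := hL μ' h
    rw [measureReal_sdiff hsub (hEm _), hE _ (by linarith [hs.1]) (by linarith [hs.2]) μ' h,
      hE _ hs.1 (by linarith [hs.2]) μ' h]
    ring

/-- Lyapunov: simultaneous fractions for three beliefs. -/
lemma lyapunov3 {Ω : Type*} [mΩ : MeasurableSpace Ω] {a b c : Measure Ω} (ha : IsBelief a)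
    (hb : IsBelief b) (hc : IsBelief c) {A : Set Ω} (hA : MeasurableSet A) {t : ℝ}
    (h0 : 0 ≤ t) (h1 : t ≤ 1) :
    ∃ E, MeasurableSet E ∧ E ⊆ A ∧ a.real E = t * a.real A ∧ b.real E = t * b.real A ∧
      c.real E = t * c.real A := by
  have := ha.1
  have := hb.1
  have := hc.1
  set ν := a + b + c with hν
  have hνE : ∀ S, ν S = a S + b S + c S := fun S => by simp [hν]
  have hsplit : ∀ (m : Measure Ω), IsBelief m → m ≤ ν → ∀ E, MeasurableSet E → 0 < m E →
      ∃ F, MeasurableSet F ∧ F ⊆ E ∧ 0 < ν F ∧ ν F < ν E := by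
    intro m hm hle E hE hpos
    have := hm.1
    obtain ⟨F, hF, hFE, hF0, hFlt⟩ := hm.2 E hE hpos
    refine ⟨F, hF, hFE, hF0.trans_le (hle F), ?_⟩
    have h1 : 0 < m (E \ F) := by
      rw [measure_sdiff hFE hF.nullMeasurableSet (measure_ne_top _ _)]
      exact tsub_pos_of_lt hFlt
    have h2 : ν E = ν F + ν (E \ F) := by
      rw [measure_add_sdiff hF.nullMeasurableSet, Set.union_eq_self_of_subset_left hFE]
    rw [h2]
    exact ENNReal.lt_add_right (measure_ne_top _ _) (h1.trans_le (hle _)).ne'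
  have hale : a ≤ ν := Measure.le_iff.2 fun S _ => by
    rw [hνE, add_assoc]; exact le_self_add
  have hble : b ≤ ν := Measure.le_iff.2 fun S _ => by
    rw [hνE]; exact le_add_self.trans le_self_add
  have hcle : c ≤ ν := Measure.le_iff.2 fun S _ => by
    rw [hνE]; exact le_add_self
  have hna : NonatomicOn ν mΩ := by
    intro E hE hpos
    by_cases h1 : 0 < a E
    · exact hsplit a ha hale E hE h1
    by_cases h2 : 0 < b E
    · exact hsplit b hb hble E hE h2
    by_cases h3 : 0 < c E
    · exact hsplit c hc hcle E hE h3
    rw [hνE] at hpos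
    simp only [not_lt, nonpos_iff_eq_zero] at h1 h2 h3
    simp [h1, h2, h3] at hpos
  have H0 : Halving [ν] := by
    intro B hB
    have hn : 0 ≤ ν.real B := measureReal_nonneg
    obtain ⟨E, h1, h2, h3⟩ := sierpinski ν hna hB (c := ν.real B / 2) (by linarith) (by linarith)
    exact ⟨E, h1, h2, by simpa using h3⟩
  have H1 := halving_cons ν _ (by simp) (by simp; infer_instance) H0 a hale
  have H2 := halving_cons ν _ (by simp) (by
    simp; exact ⟨inferInstance, inferInstance⟩) H1 b hble
  have H3 := halving_cons ν _ (by simp) (by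
    simp; exact ⟨inferInstance, inferInstance, inferInstance⟩) H2 c hcle
  obtain ⟨E, -, hm, hs, hE⟩ := chain_of_halving _ (by
    simp; exact ⟨inferInstance, inferInstance, inferInstance, inferInstance⟩) H3 hA
  have := hE t h0 h1
  exact ⟨E t, hm t, hs t, this a (by simp), this b (by simp), this c (by simp)⟩

lemma lyapunov3_convex {Ω : Type*} [mΩ : MeasurableSpace Ω] {a b c : Measure Ω} (ha : IsBelief a)
    (hb : IsBelief b) (hc : IsBelief c) {A B : Set Ω} (hA : MeasurableSet A)
    (hB : MeasurableSet B) {t : ℝ} (h0 : 0 ≤ t) (h1 : t ≤ 1) :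
    ∃ C, MeasurableSet C ∧ a.real C = t * a.real A + (1 - t) * a.real B ∧
      b.real C = t * b.real A + (1 - t) * b.real B ∧
      c.real C = t * c.real A + (1 - t) * c.real B := by
  obtain ⟨E, hE, hEs, ea, eb, ec⟩ := lyapunov3 ha hb hc (hA.diff hB) h0 h1
  obtain ⟨F, hF, hFs, fa, fb, fc⟩ := lyapunov3 ha hb hc (hB.diff hA) (t := 1 - t)
    (by linarith) (by linarith)
  have key : ∀ μ : Measure Ω, IsProbabilityMeasure μ → μ.real E = t * μ.real (A \ B) →
      μ.real F = (1 - t) * μ.real (B \ A) →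
      μ.real ((A ∩ B) ∪ (E ∪ F)) = t * μ.real A + (1 - t) * μ.real B := by
    intro μ _ h1 h2
    have d1 : Disjoint E F := Set.disjoint_left.2 fun x hx hx' => (hFs hx').2 (hEs hx).1
    have d2 : Disjoint (A ∩ B) (E ∪ F) := Set.disjoint_left.2 fun x hx hx' => by
      rcases hx' with h | h
      · exact (hEs h).2 hx.2
      · exact (hFs h).2 hx.1
    rw [measureReal_union d2 (hE.union hF), measureReal_union d1 hF, h1, h2]
    have e1 := measureReal_inter_add_sdiff (μ := μ) (s := A) hB
    have e2 := measureReal_inter_add_sdiff (μ := μ) (s := B) hA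
    rw [Set.inter_comm] at e2
    rw [← e1, ← e2]; ring
  exact ⟨(A ∩ B) ∪ (E ∪ F), (hA.inter hB).union (hE.union hF), key a ha.1 ea fa, key b hb.1 eb fb,
    key c hc.1 ec fc⟩

open Classical in
/-- The act giving `x` on `E` and `y` off `E`. -/
noncomputable def binAct {Ω O : Type*} [MeasurableSpace Ω] [MeasurableSpace O] (x y : O)
    {E : Set Ω} (hE : MeasurableSet E) : Act Ω O :=
  ⟨fun ω => if ω ∈ E then x else y, Measurable.ite hE measurable_const measurable_const⟩

lemma ev_binAct {Ω O : Type*} [MeasurableSpace Ω] [MeasurableSpace O] (x y : O)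
    {E : Set Ω} (hE : MeasurableSet E) (π : Measure Ω) [IsProbabilityMeasure π] (u : O → ℝ) :
    ev π u (binAct x y hE) = u y + (u x - u y) * π.real E := by
  have : ∀ ω, u ((binAct x y hE).1 ω) = u y + E.indicator (fun _ => u x - u y) ω := by
    intro ω
    by_cases h : ω ∈ E <;> simp [binAct, h]
  unfold ev
  simp only [this]
  rw [integral_add (integrable_const _) ((integrable_const _).indicator hE),
    integral_indicator hE]
  simp [mul_comm]

lemma map_binAct {Ω O : Type*} [MeasurableSpace Ω] [MeasurableSpace O] (x y : O)
    {E : Set Ω} (hE : MeasurableSet E) (π π' : Measure Ω) [IsProbabilityMeasure π]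
    [IsProbabilityMeasure π'] (h : π.real E = π'.real E) :
    Measure.map (binAct x y hE).1 π = Measure.map (binAct x y hE).1 π' := by
  ext S hS
  have hm := (binAct x y hE).2
  rw [Measure.map_apply hm hS, Measure.map_apply hm hS]
  have h1 : π E = π' E := (measureReal_eq_measureReal_iff).1 h
  have h2 : π Eᶜ = π' Eᶜ := by rw [prob_compl_eq_one_sub hE, prob_compl_eq_one_sub hE, h1]
  classical
  have : (binAct x y hE).1 ⁻¹' S = if x ∈ S then (if y ∈ S then Set.univ else E) else
      (if y ∈ S then Eᶜ else ∅) := by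
    ext ω
    by_cases h : ω ∈ E <;> by_cases hx : x ∈ S <;> by_cases hy : y ∈ S <;>
      simp [binAct, h, hx, hy]
  rw [this]
  split_ifs <;> simp [h1, h2]

lemma lottery_aux {Ω O : Type*} [MeasurableSpace Ω] [MeasurableSpace O] {a b c : Measure Ω}
    (ha : IsBelief a) (hb : IsBelief b) (hc : IsBelief c) (x0 : O) (w : O → ℝ)
    (s : Finset O) :
    (∀ x ∈ s, 0 ≤ w x) → (∑ x ∈ s, w x ≤ 1) →
    ∃ (f : Act Ω O) (A : Set Ω), MeasurableSet A ∧ ∀ μ, (μ = a ∨ μ = b ∨ μ = c) →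
      μ.real A = 1 - ∑ x ∈ s, w x ∧ ∀ h : O → ℝ, IsUtility h →
        ∫ ω in Aᶜ, h (f.1 ω) ∂μ = ∑ x ∈ s, w x * h x := by
  classical
  have hprob : ∀ μ, (μ = a ∨ μ = b ∨ μ = c) → IsProbabilityMeasure μ := by
    rintro μ (rfl | rfl | rfl)
    exacts [ha.1, hb.1, hc.1]
  induction s using Finset.induction_on with
  | empty =>
    intro _ _
    refine ⟨⟨fun _ => x0, measurable_const⟩, Set.univ, MeasurableSet.univ, fun μ hμ => ?_⟩
    have := hprob μ hμ
    simp
  | insert x s hx ih =>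
    intro hw hs
    rw [Finset.sum_insert hx] at hs
    have hwx := hw x (Finset.mem_insert_self _ _)
    obtain ⟨f, A, hA, hf⟩ := ih (fun y hy => hw y (Finset.mem_insert_of_mem hy)) (by linarith)
    set q := 1 - ∑ x ∈ s, w x with hq
    have hq0 : 0 ≤ q := by linarith
    have hwq : w x ≤ q := by linarith
    have htq : w x / q * q = w x := by
      rcases hq0.eq_or_lt with h | h
      · have : w x = 0 := by linarith
        simp [this]
      · field_simp
    obtain ⟨E, hE, hEA, e1, e2, e3⟩ := lyapunov3 ha hb hc hA (t := w x / q)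
      (div_nonneg hwx hq0) (div_le_one_of_le₀ hwq hq0)
    have hEμ : ∀ μ, (μ = a ∨ μ = b ∨ μ = c) → μ.real E = w x := by
      intro μ hμ
      have := (hf μ hμ).1
      rcases hμ with rfl | rfl | rfl
      · rw [e1, this, htq]
      · rw [e2, this, htq]
      · rw [e3, this, htq]
    refine ⟨⟨fun ω => if ω ∈ E then x else f.1 ω, Measurable.ite hE measurable_const f.2⟩,
      A \ E, hA.diff hE, fun μ hμ => ⟨?_, fun h hh => ?_⟩⟩
    · have := hprob μ hμ
      rw [measureReal_sdiff hEA hE, hEμ μ hμ, (hf μ hμ).1, Finset.sum_insert hx]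
      linarith
    · have := hprob μ hμ
      have hd : Disjoint Aᶜ E := Set.disjoint_left.2 fun y hy hy' => hy (hEA hy')
      have hset : (A \ E)ᶜ = Aᶜ ∪ E := by
        ext y; simp only [Set.mem_compl_iff, Set.mem_sdiff, Set.mem_union]; tauto
      have hg : Measurable (fun ω => h (if ω ∈ E then x else f.1 ω)) :=
        hh.1.comp (Measurable.ite hE measurable_const f.2)
      obtain ⟨M, hM⟩ := hh.2
      have hIntg : Integrable (fun ω => h (if ω ∈ E then x else f.1 ω)) μ :=
        Integrable.of_bound hg.aestronglyMeasurable M (Filter.Eventually.of_forall fun ω => hM _)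
      rw [hset, setIntegral_union hd hE hIntg.integrableOn hIntg.integrableOn,
        Finset.sum_insert hx, ← (hf μ hμ).2 h hh]
      have i1 : ∫ ω in Aᶜ, h (if ω ∈ E then x else f.1 ω) ∂μ = ∫ ω in Aᶜ, h (f.1 ω) ∂μ := by
        refine setIntegral_congr_fun hA.compl fun ω hω => ?_
        have : ω ∉ E := fun h' => hω (hEA h')
        simp [this]
      have i2 : ∫ ω in E, h (if ω ∈ E then x else f.1 ω) ∂μ = ∫ ω in E, h x ∂μ := by
        refine setIntegral_congr_fun hE fun ω hω => ?_
        have : ω ∈ E := hω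
        simp [this]
      rw [i1, i2, setIntegral_const, hEμ μ hμ, smul_eq_mul]
      ring

lemma lottery {Ω O : Type*} [MeasurableSpace Ω] [MeasurableSpace O] {a b c : Measure Ω}
    (ha : IsBelief a) (hb : IsBelief b) (hc : IsBelief c) (w : O → ℝ)
    (s : Finset O) (hw : ∀ x ∈ s, 0 ≤ w x) (hs : ∑ x ∈ s, w x = 1) :
    ∃ f : Act Ω O, Measure.map f.1 a = Measure.map f.1 b ∧ ∀ μ, (μ = a ∨ μ = b ∨ μ = c) →
      ∀ h : O → ℝ, IsUtility h → ev μ h f = ∑ x ∈ s, w x * h x := by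
  classical
  have hprob : ∀ μ, (μ = a ∨ μ = b ∨ μ = c) → IsProbabilityMeasure μ := by
    rintro μ (rfl | rfl | rfl)
    exacts [ha.1, hb.1, hc.1]
  obtain ⟨x0, -⟩ : s.Nonempty := by
    rw [Finset.nonempty_iff_ne_empty]; rintro rfl; simp at hs
  obtain ⟨f, A, hA, hf⟩ := lottery_aux ha hb hc x0 w s hw hs.le
  have key : ∀ μ, (μ = a ∨ μ = b ∨ μ = c) →
      ∀ h : O → ℝ, IsUtility h → ev μ h f = ∑ x ∈ s, w x * h x := by
    intro μ hμ h hh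
    have := hprob μ hμ
    obtain ⟨h1, h2⟩ := hf μ hμ
    rw [hs, sub_self] at h1
    have h3 : μ A = 0 := (measureReal_eq_zero_iff).1 h1
    obtain ⟨M, hM⟩ := hh.2
    have hIntg : Integrable (fun ω => h (f.1 ω)) μ :=
      Integrable.of_bound (hh.1.comp f.2).aestronglyMeasurable M
        (Filter.Eventually.of_forall fun ω => hM _)
    rw [← h2 h hh, ev, ← integral_add_compl hA hIntg, setIntegral_measure_zero _ h3, zero_add]
  refine ⟨f, ?_, key⟩
  have := ha.1
  have := hb.1
  ext S hS
  rw [Measure.map_apply f.2 hS, Measure.map_apply f.2 hS]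
  have hu : IsUtility (S.indicator (fun _ => (1:ℝ))) :=
    ⟨measurable_const.indicator hS, 1, fun x => by by_cases h : x ∈ S <;> simp [h]⟩
  have hev : ∀ μ, (μ = a ∨ μ = b ∨ μ = c) →
      ev μ (S.indicator (fun _ => (1:ℝ))) f = μ.real (f.1 ⁻¹' S) := by
    intro μ hμ
    have := hprob μ hμ
    have : ∀ ω, S.indicator (fun _ => (1:ℝ)) (f.1 ω) =
        (f.1 ⁻¹' S).indicator (fun _ => (1:ℝ)) ω := fun ω => rfl
    unfold ev
    simp only [this]
    rw [integral_indicator (f.2 hS)]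
    simp
  have e1 := hev a (by simp)
  have e2 := hev b (by simp)
  rw [key a (by simp) _ hu] at e1
  rw [key b (by simp) _ hu] at e2
  exact (measureReal_eq_measureReal_iff).1 (e1.symm.trans e2)

lemma acts_of_signed {Ω O : Type*} [MeasurableSpace Ω] [MeasurableSpace O] {a b c : Measure Ω}
    (ha : IsBelief a) (hb : IsBelief b) (hc : IsBelief c) (m : O → ℝ)
    (s : Finset O) (hs : ∑ x ∈ s, m x = 0) (hne : ∃ x ∈ s, m x ≠ 0) :
    ∃ (K : ℝ) (f g : Act Ω O), 0 < K ∧ Measure.map f.1 a = Measure.map f.1 b ∧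
      Measure.map g.1 a = Measure.map g.1 b ∧ ∀ μ, (μ = a ∨ μ = b ∨ μ = c) →
      ∀ h : O → ℝ, IsUtility h → ev μ h f - ev μ h g = K * ∑ x ∈ s, m x * h x := by
  set T := ∑ x ∈ s, (m x)⁺ with hT
  have hT' : ∑ x ∈ s, (m x)⁻ = T := by
    have : ∑ x ∈ s, ((m x)⁺ - (m x)⁻) = 0 := by
      rw [← hs]; exact Finset.sum_congr rfl fun x _ => posPart_sub_negPart _
    rw [Finset.sum_sub_distrib] at this
    linarith
  have hT0 : 0 < T := by
    rcases (Finset.sum_nonneg (fun x _ => posPart_nonneg (m x)) : 0 ≤ T).eq_or_lt with h | h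
    · exfalso
      obtain ⟨x, hx, hmx⟩ := hne
      have h1 := (Finset.sum_eq_zero_iff_of_nonneg (fun x _ => posPart_nonneg (m x))).1 h.symm x hx
      have h2 := (Finset.sum_eq_zero_iff_of_nonneg (fun x _ => negPart_nonneg (m x))).1
        (hT'.trans h.symm) x hx
      have h3 := posPart_sub_negPart (m x)
      rw [h1, h2] at h3
      exact hmx (by linarith)
    · exact h
  obtain ⟨f, hf1, hf2⟩ := lottery ha hb hc (fun x => (m x)⁺ / T) s
    (fun x _ => div_nonneg (posPart_nonneg _) hT0.le)
    (by rw [← Finset.sum_div, ← hT, div_self hT0.ne'])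
  obtain ⟨g, hg1, hg2⟩ := lottery ha hb hc (fun x => (m x)⁻ / T) s
    (fun x _ => div_nonneg (negPart_nonneg _) hT0.le)
    (by rw [← Finset.sum_div, hT', div_self hT0.ne'])
  refine ⟨T⁻¹, f, g, inv_pos.2 hT0, hf1, hg1, fun μ hμ h hh => ?_⟩
  rw [hf2 μ hμ h hh, hg2 μ hμ h hh, ← Finset.sum_sub_distrib, Finset.mul_sum]
  refine Finset.sum_congr rfl fun x _ => ?_
  have h3 := posPart_sub_negPart (m x)
  linear_combination (h x / T) * h3

lemma exists_signed {O I : Type*} (J : Finset I) (ua : I → O → ℝ)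
    (hlin : UtilsLinIndep J ua) {i : I} (hi : i ∈ J) :
    ∃ (s : Finset O) (m : O → ℝ), ∑ x ∈ s, m x = 0 ∧
      (∀ j ∈ J, j ≠ i → ∑ x ∈ s, m x * ua j x = 0) ∧ ∑ x ∈ s, m x * ua i x ≠ 0 := by
  classical
  by_contra! hcon
  let L : (O → ℝ) → (O →₀ ℝ) →ₗ[ℝ] ℝ := fun u => Finsupp.linearCombination ℝ u
  have hLap : ∀ (u : O → ℝ) (m : O →₀ ℝ), L u m = ∑ x ∈ m.support, m x * u x := fun u m => by
    simp [L, Finsupp.linearCombination_apply, Finsupp.sum]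
  let F : Option (J.erase i) → (O →₀ ℝ) →ₗ[ℝ] ℝ := fun o =>
    match o with
    | none => L (fun _ => 1)
    | some j => L (ua j)
  have hmem : L (ua i) ∈ Submodule.span ℝ (Set.range F) := by
    refine mem_span_of_iInf_ker_le_ker fun m hm => ?_
    rw [Submodule.mem_iInf] at hm
    rw [LinearMap.mem_ker, hLap]
    refine hcon m.support m ?_ ?_
    · have := hm none
      rw [LinearMap.mem_ker] at this
      simpa [F, hLap] using this
    · intro j hj hji
      have := hm (some ⟨j, Finset.mem_erase.2 ⟨hji, hj⟩⟩)
      rw [LinearMap.mem_ker] at this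
      simpa [F, hLap] using this
  obtain ⟨c, hc⟩ := (Submodule.mem_span_range_iff_exists_fun ℝ).1 hmem
  have hx : ∀ x, c none + ∑ j : J.erase i, c (some j) * ua j x = ua i x := by
    intro x
    have := congrArg (fun l => l (Finsupp.single x 1)) hc
    simpa [F, L, Fintype.sum_option] using this
  let d : I → ℝ := fun j => if h : j ∈ J.erase i then c (some ⟨j, h⟩) else -1
  have hd : d i = 0 := by
    refine hlin d ⟨-c none, fun x => ?_⟩ i hi
    rw [← Finset.add_sum_erase J _ hi, ← Finset.sum_coe_sort (J.erase i)]
    have h1 : d i = -1 := by simp [d]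
    have h2 : ∀ j : J.erase i, d j = c (some j) := fun j => by
      have := j.2
      simp only [d, this, dif_pos]
    simp only [h1, h2]
    linarith [hx x]
  simp [d] at hd

section Social

variable {Ω O I : Type*} [mΩ : MeasurableSpace Ω] [mO : MeasurableSpace O]

lemma exists_ne_of_not_indiff {π : Measure Ω} {u : O → ℝ} {r : Pref Ω O}
    (hr : Represents π u r) (h : ¬ CompletelyIndifferent r) : ∃ x y, u x ≠ u y := by
  by_contra! hc
  refine h fun f g => (hr f g).2 (le_of_eq ?_)
  unfold ev
  exact integral_congr_ae (Filter.Eventually.of_forall fun ω => hc _ _)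

lemma isUtility_zero : IsUtility (0 : O → ℝ) := ⟨measurable_const, 0, by simp⟩

lemma represents_zero {π : Measure Ω} {r : Pref Ω O} (h : CompletelyIndifferent r) :
    Represents π (0 : O → ℝ) r := fun f g => by
  simp [ev, h f g]

lemma isUtility_of_norm {u : O → ℝ} (h : NormalizedUtilityBar u) : IsUtility u := by
  rcases h with h | rfl
  · refine ⟨h.1, 1, fun x => ?_⟩
    have h0 := h.2.1.1 (Set.mem_range_self x)
    have h1 := h.2.2.1 (Set.mem_range_self x)
    exact abs_le.2 ⟨by linarith, h1⟩
  · exact isUtility_zero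

lemma representsBelief_unique {π π' : Measure Ω} {r : Pref Ω O} (h : ¬ CompletelyIndifferent r)
    (hπ : RepresentsBelief π r) (hπ' : RepresentsBelief π' r) {E : Set Ω}
    (hE : MeasurableSet E) : π.real E = π'.real E := by
  obtain ⟨hb, u, hu, hr⟩ := hπ
  obtain ⟨hb', u', hu', hr'⟩ := hπ'
  have := hb.1
  have := hb'.1
  obtain ⟨x, y, hxy⟩ := exists_ne_of_not_indiff hr' h
  obtain ⟨F, hF, -, f1, f2, -⟩ := lyapunov3 hb hb' hb MeasurableSet.univ
    (t := π.real E) measureReal_nonneg measureReal_le_one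
  simp only [probReal_univ, mul_one] at f1 f2
  have e1 : ev π u (binAct x y hE) = ev π u (binAct x y hF) := by
    rw [ev_binAct, ev_binAct, f1]
  have e2 : ev π' u' (binAct x y hE) = ev π' u' (binAct x y hF) :=
    le_antisymm ((hr' _ _).1 ((hr _ _).2 e1.le)) ((hr' _ _).1 ((hr _ _).2 e1.ge))
  rw [ev_binAct, ev_binAct, f2] at e2
  have h3 : (u' x - u' y) ≠ 0 := sub_ne_zero.2 hxy
  have := mul_left_cancel₀ h3 (add_left_cancel e2)
  exact this.symm

/-- Key step: the new social belief lies on the line through the old one and agent `i`'s. -/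
lemma key_belief {Φ : (I → Pref Ω O) → Pref Ω O} (hmono : RestrictedMonotonicity Φ)
    {p : I → Pref Ω O} (hp : IsProfile p) (i : I) {π0 π1 π : Measure Ω}
    (h0 : RepresentsBelief π0 (Φ (updIndiff p i))) (h1 : RepresentsBelief π1 (p i))
    (h : RepresentsBelief π (Φ p)) (hn : ¬ CompletelyIndifferent (Φ p)) :
    ∃ l : ℝ, ∀ E, MeasurableSet E → π.real E = (1 + l) * π0.real E - l * π1.real E := by
  have hm := hmono i p hp π0 π1 h0 h1
  obtain ⟨hb0, u0, hu0, hr0⟩ := h0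
  obtain ⟨hb1, u1, hu1, hr1⟩ := h1
  obtain ⟨hb, u, hu, hr⟩ := h
  have := hb.1
  have := hb0.1
  have := hb1.1
  obtain ⟨x, y, hxy⟩ := exists_ne_of_not_indiff hr hn
  -- common value
  have key : ∀ E, MeasurableSet E → π0.real E = π1.real E → π.real E = π0.real E := by
    intro E hE hEq
    obtain ⟨F, hF, -, f0, f1, f2⟩ := lyapunov3 hb0 hb1 hb MeasurableSet.univ
      (t := π0.real E) measureReal_nonneg measureReal_le_one
    simp only [probReal_univ, mul_one] at f0 f1 f2
    have e0 : ev π0 u0 (binAct x y hE) = ev π0 u0 (binAct x y hF) := by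
      rw [ev_binAct, ev_binAct, f0]
    have e1 : ev π1 u1 (binAct x y hE) = ev π1 u1 (binAct x y hF) := by
      rw [ev_binAct, ev_binAct, f1, hEq]
    have m1 := map_binAct x y hE π0 π1 hEq
    have m2 := map_binAct x y hF π0 π1 (f0.trans f1.symm)
    have a1 := (hm _ _ ((hr0 _ _).2 e0.ge) ((hr0 _ _).2 e0.le) m1 m2).1 ((hr1 _ _).2 e1.ge)
    have a2 := (hm _ _ ((hr0 _ _).2 e0.le) ((hr0 _ _).2 e0.ge) m2 m1).1 ((hr1 _ _).2 e1.le)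
    have e2 := le_antisymm ((hr _ _).1 a1) ((hr _ _).1 a2)
    rw [ev_binAct, ev_binAct, f2] at e2
    exact (mul_left_cancel₀ (sub_ne_zero.2 hxy) (add_left_cancel e2)).symm
  by_cases hall : ∀ E, MeasurableSet E → π0.real E = π1.real E
  · exact ⟨0, fun E hE => by rw [key E hE (hall E hE)]; ring⟩
  push Not at hall
  obtain ⟨E0, hE0, hne0⟩ := hall
  obtain ⟨E, hE, hne⟩ : ∃ E, MeasurableSet E ∧ 0 < π0.real E - π1.real E := by
    rcases lt_or_gt_of_ne hne0 with h | h
    · refine ⟨E0ᶜ, hE0.compl, ?_⟩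
      rw [probReal_compl_eq_one_sub hE0, probReal_compl_eq_one_sub hE0]
      linarith
    · exact ⟨E0, hE0, by linarith⟩
  have opp : ∀ A, MeasurableSet A → π0.real A - π1.real A ≤ 0 →
      (π.real A - π0.real A) * (π0.real E - π1.real E) =
        (π.real E - π0.real E) * (π0.real A - π1.real A) := by
    intro A hA hle
    set dE := π0.real E - π1.real E with hdE
    set dA := π0.real A - π1.real A with hdA
    have hpos : 0 < dE - dA := by linarith
    obtain ⟨C, hC, c0, c1, c2⟩ := lyapunov3_convex hb0 hb1 hb hE hA (t := -dA / (dE - dA))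
      (div_nonneg (by linarith) hpos.le) ((div_le_one hpos).2 (by linarith))
    set t := -dA / (dE - dA) with ht
    have htm : t * (dE - dA) = -dA := by rw [ht]; field_simp
    have hk := key C hC (by rw [c0, c1]; linear_combination htm)
    rw [c0, c2] at hk
    have h5 : t * (π.real E - π0.real E) + (1 - t) * (π.real A - π0.real A) = 0 := by
      linear_combination hk
    linear_combination (dE - dA) * h5 -
      (π.real E - π0.real E - (π.real A - π0.real A)) * htm
  have all : ∀ A, MeasurableSet A →
      (π.real A - π0.real A) * (π0.real E - π1.real E) =
        (π.real E - π0.real E) * (π0.real A - π1.real A) := by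
    intro A hA
    rcases le_total (π0.real A - π1.real A) 0 with h | h
    · exact opp A hA h
    · have := opp Aᶜ hA.compl
      rw [probReal_compl_eq_one_sub hA, probReal_compl_eq_one_sub hA,
        probReal_compl_eq_one_sub hA] at this
      have := this (by linarith)
      linear_combination -this
  refine ⟨(π.real E - π0.real E) / (π0.real E - π1.real E), fun A hA => ?_⟩
  have := all A hA
  field_simp
  linear_combination this

/-- Key step for utilities. -/
lemma key_util {Φ : (I → Pref Ω O) → Pref Ω O} (hmono : RestrictedMonotonicity Φ)
    {p : I → Pref Ω O} (hp : IsProfile p) (i : I) {π0 π1 π : Measure Ω} {u0 u1 u : O → ℝ}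
    (hb0 : IsBelief π0) (hu0 : IsUtility u0) (hr0 : Represents π0 u0 (Φ (updIndiff p i)))
    (hb1 : IsBelief π1) (hu1 : IsUtility u1) (hr1 : Represents π1 u1 (p i))
    (hb : IsBelief π) (hu : IsUtility u) (hr : Represents π u (Φ p))
    (s : Finset O) (m : O → ℝ) (hs : ∑ x ∈ s, m x = 0) (hm0 : ∑ x ∈ s, m x * u0 x = 0) :
    (∑ x ∈ s, m x * u1 x = 0 → ∑ x ∈ s, m x * u x = 0) ∧
    (∑ x ∈ s, m x * u1 x ≠ 0 → ¬ CompletelyIndifferent (Φ p)) := by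
  by_cases hne : ∃ x ∈ s, m x ≠ 0
  swap
  · push Not at hne
    have hz : ∀ h : O → ℝ, ∑ x ∈ s, m x * h x = 0 := fun h =>
      Finset.sum_eq_zero fun x hx => by rw [hne x hx, zero_mul]
    exact ⟨fun _ => hz u, fun h => (h (hz u1)).elim⟩
  have hm := hmono i p hp π0 π1 ⟨hb0, u0, hu0, hr0⟩ ⟨hb1, u1, hu1, hr1⟩
  obtain ⟨K, f, g, hK, mf, mg, hev⟩ := acts_of_signed hb0 hb1 hb m s hs hne
  have e0 : ev π0 u0 f = ev π0 u0 g := by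
    have := hev π0 (by simp) u0 hu0
    rw [hm0, mul_zero] at this
    linarith
  have e1 := hev π1 (by simp) u1 hu1
  have e2 := hev π (by simp) u hu
  have A := hm f g ((hr0 _ _).2 e0.ge) ((hr0 _ _).2 e0.le) mf mg
  have B := hm g f ((hr0 _ _).2 e0.le) ((hr0 _ _).2 e0.ge) mg mf
  constructor
  · intro h
    rw [h, mul_zero] at e1
    have a1 := (hr _ _).1 (A.1 ((hr1 _ _).2 (by linarith)))
    have a2 := (hr _ _).1 (B.1 ((hr1 _ _).2 (by linarith)))
    have : K * ∑ x ∈ s, m x * u x = 0 := by linarith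
    exact (mul_eq_zero.1 this).resolve_left hK.ne'
  · intro h hCI
    rcases lt_or_gt_of_ne h with h | h
    · have : K * ∑ x ∈ s, m x * u1 x < 0 := mul_neg_of_pos_of_neg hK h
      refine (B.2 ⟨(hr1 _ _).2 (by linarith), fun h' => ?_⟩).2 (hCI _ _)
      have := (hr1 _ _).1 h'
      linarith
    · have : 0 < K * ∑ x ∈ s, m x * u1 x := mul_pos hK h
      refine (A.2 ⟨(hr1 _ _).2 (by linarith), fun h' => ?_⟩).2 (hCI _ _)
      have := (hr1 _ _).1 h'
      linarith

lemma isProfile_updIndiff {p : I → Pref Ω O} (hp : IsProfile p) (i : I) :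
    IsProfile (updIndiff p i) := by
  intro j
  unfold updIndiff
  split_ifs
  · obtain ⟨π, u, hb, -, -⟩ := hp i
    exact ⟨π, 0, hb, isUtility_zero, represents_zero fun _ _ => trivial⟩
  · exact hp j

lemma mem_concerned [Fintype I] {p : I → Pref Ω O} {i : I} :
    i ∈ concerned p ↔ ¬ CompletelyIndifferent (p i) := by
  classical
  exact Finset.mem_filter.trans (by simp)

open Classical in
lemma concerned_updIndiff [Fintype I] (p : I → Pref Ω O) (i : I) :
    concerned (updIndiff p i) = (concerned p).erase i := by
  ext j
  rw [Finset.mem_erase, mem_concerned, mem_concerned, updIndiff]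
  by_cases h : j = i
  · simp [h, CompletelyIndifferent, indiffRel]
  · simp [h]

lemma updIndiff_ne {p : I → Pref Ω O} {i j : I} (h : j ≠ i) : updIndiff p i j = p j := by
  simp [updIndiff, h]

lemma not_indiff_of_mem [Fintype I] {p : I → Pref Ω O} {i : I} (h : i ∈ concerned p) :
    ¬ CompletelyIndifferent (p i) := by
  simpa [concerned] using h

lemma faithful_empty [Fintype I] {Φ : (I → Pref Ω O) → Pref Ω O} (hf : Faithful Φ)
    {p : I → Pref Ω O} (hp : IsProfile p) (h : concerned p = ∅) :
    CompletelyIndifferent (Φ p) := by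
  refine hf p hp fun i => ?_
  by_contra hi
  have : i ∈ concerned p := by simpa [concerned] using hi
  simp [h] at this

/-- Representations of the concerned agents. -/
def RepC [Fintype I] (p : I → Pref Ω O) (πa : I → Measure Ω) (ua : I → O → ℝ) : Prop :=
  ∀ i ∈ concerned p, IsBelief (πa i) ∧ IsUtility (ua i) ∧ Represents (πa i) (ua i) (p i)

lemma RepC.upd [Fintype I] {p : I → Pref Ω O} {πa : I → Measure Ω} {ua : I → O → ℝ}
    (h : RepC p πa ua) (i : I) : RepC (updIndiff p i) πa ua := by
  classical
  intro j hj
  rw [concerned_updIndiff, Finset.mem_erase] at hj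
  rw [updIndiff_ne hj.1]
  exact h j hj.2

lemma util_span [Fintype I] {Φ : (I → Pref Ω O) → Pref Ω O}
    (hSWF : ∀ p : I → Pref Ω O, IsProfile p → IsSEU (Φ p))
    (hmono : RestrictedMonotonicity Φ) (hfaith : Faithful Φ)
    (πa : I → Measure Ω) (ua : I → O → ℝ) (s : Finset O) (m : O → ℝ) (hs : ∑ x ∈ s, m x = 0)
    (n : ℕ) : ∀ p : I → Pref Ω O, IsProfile p → RepC p πa ua → (concerned p).card = n →
      (∀ j ∈ concerned p, ∑ x ∈ s, m x * ua j x = 0) →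
      ∀ π u, IsBelief π → IsUtility u → Represents π u (Φ p) → ∑ x ∈ s, m x * u x = 0 := by
  classical
  induction n with
  | zero =>
    intro p hp _ hcard _ π u hb hu hr
    have hCI := faithful_empty hfaith hp (Finset.card_eq_zero.1 hcard)
    have := hb.1
    have hc : ∀ x y, u x ≤ u y := fun x y => by
      have := (hr ⟨fun _ => y, measurable_const⟩ ⟨fun _ => x, measurable_const⟩).1 (hCI _ _)
      simpa [ev] using this
    rcases s.eq_empty_or_nonempty with rfl | ⟨x0, -⟩
    · simp
    · have : ∀ x, u x = u x0 := fun x => le_antisymm (hc _ _) (hc _ _)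
      simp only [this]
      rw [← Finset.sum_mul, hs, zero_mul]
  | succ n ih =>
    intro p hp hR hcard hz π u hb hu hr
    obtain ⟨i, hi⟩ := Finset.card_pos.1 (by omega : 0 < (concerned p).card)
    have hp' := isProfile_updIndiff hp i
    obtain ⟨π0, u0, hb0, hu0, hr0⟩ := hSWF _ hp'
    have hce := concerned_updIndiff p i
    have hm0 := ih (updIndiff p i) hp' (hR.upd i)
      (by rw [hce, Finset.card_erase_of_mem hi, hcard]; rfl)
      (fun j hj => hz j (by rw [hce] at hj; exact Finset.mem_of_mem_erase hj)) π0 u0 hb0 hu0 hr0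
    obtain ⟨hb1, hu1, hr1⟩ := hR i hi
    exact (key_util hmono hp i hb0 hu0 hr0 hb1 hu1 hr1 hb hu hr s m hs hm0).1 (hz i hi)

lemma not_indiff_of_linIndep [Fintype I] {Φ : (I → Pref Ω O) → Pref Ω O}
    (hSWF : ∀ p : I → Pref Ω O, IsProfile p → IsSEU (Φ p))
    (hmono : RestrictedMonotonicity Φ) (hfaith : Faithful Φ)
    {πa : I → Measure Ω} {ua : I → O → ℝ} {p : I → Pref Ω O} (hp : IsProfile p)
    (hR : RepC p πa ua) (hlin : UtilsLinIndep (concerned p) ua) (hne : (concerned p).Nonempty) :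
    ¬ CompletelyIndifferent (Φ p) := by
  classical
  obtain ⟨i, hi⟩ := hne
  obtain ⟨s, m, hs, hj, hmi⟩ := exists_signed (concerned p) ua hlin hi
  have hp' := isProfile_updIndiff hp i
  obtain ⟨π0, u0, hb0, hu0, hr0⟩ := hSWF _ hp'
  obtain ⟨π, u, hb, hu, hr⟩ := hSWF _ hp
  obtain ⟨hb1, hu1, hr1⟩ := hR i hi
  have hm0 := util_span hSWF hmono hfaith πa ua s m hs _ (updIndiff p i) hp' (hR.upd i) rfl
    (fun j h => by
      rw [concerned_updIndiff, Finset.mem_erase] at h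
      exact hj j h.2 h.1) π0 u0 hb0 hu0 hr0
  exact (key_util hmono hp i hb0 hu0 hr0 hb1 hu1 hr1 hb hu hr s m hs hm0).2 hmi

lemma belief_span [Fintype I] {Φ : (I → Pref Ω O) → Pref Ω O}
    (hSWF : ∀ p : I → Pref Ω O, IsProfile p → IsSEU (Φ p))
    (hmono : RestrictedMonotonicity Φ) (hfaith : Faithful Φ)
    (πa : I → Measure Ω) (ua : I → O → ℝ)
    (n : ℕ) : ∀ p : I → Pref Ω O, IsProfile p → RepC p πa ua → (concerned p).card = n →
      ¬ CompletelyIndifferent (Φ p) → ∀ π, RepresentsBelief π (Φ p) →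
      ∃ v : I → ℝ, ∑ i ∈ concerned p, v i = 1 ∧ ∀ E, MeasurableSet E →
        π.real E = ∑ i ∈ concerned p, v i * (πa i).real E := by
  classical
  induction n with
  | zero =>
    intro p hp _ hcard hn
    exact (hn (faithful_empty hfaith hp (Finset.card_eq_zero.1 hcard))).elim
  | succ n ih =>
    intro p hp hR hcard hn π hπ
    obtain ⟨i, hi⟩ := Finset.card_pos.1 (by omega : 0 < (concerned p).card)
    have hp' := isProfile_updIndiff hp i
    have hce := concerned_updIndiff p i
    obtain ⟨hb1, hu1, hr1⟩ := hR i hi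
    by_cases hCI : CompletelyIndifferent (Φ (updIndiff p i))
    · obtain ⟨l, hl⟩ := key_belief hmono hp i (π0 := πa i) (π1 := πa i)
        ⟨hb1, 0, isUtility_zero, represents_zero hCI⟩ ⟨hb1, ua i, hu1, hr1⟩ hπ hn
      refine ⟨fun j => if j = i then 1 else 0, by simp [hi], fun E hE => ?_⟩
      rw [hl E hE]
      simp [hi]
      ring
    · obtain ⟨π0, u0, hb0, hu0, hr0⟩ := hSWF _ hp'
      have h0 : RepresentsBelief π0 (Φ (updIndiff p i)) := ⟨hb0, u0, hu0, hr0⟩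
      obtain ⟨v0, hv0, hv0E⟩ := ih (updIndiff p i) hp' (hR.upd i)
        (by rw [hce, Finset.card_erase_of_mem hi, hcard]; rfl) hCI π0 h0
      obtain ⟨l, hl⟩ := key_belief hmono hp i h0 ⟨hb1, ua i, hu1, hr1⟩ hπ hn
      rw [hce] at hv0 hv0E
      have hcong : ∀ c : I → ℝ, ∑ j ∈ (concerned p).erase i,
          (if j = i then -l else (1 + l) * v0 j) * c j =
          (1 + l) * ∑ j ∈ (concerned p).erase i, v0 j * c j := by
        intro c
        rw [Finset.mul_sum]
        refine Finset.sum_congr rfl fun j hj => ?_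
        rw [if_neg (Finset.ne_of_mem_erase hj)]; ring
      refine ⟨fun j => if j = i then -l else (1 + l) * v0 j, ?_, fun E hE => ?_⟩
      · rw [← Finset.add_sum_erase _ _ hi]
        have := hcong (fun _ => 1)
        simp only [mul_one] at this
        rw [this, hv0, if_pos rfl]; ring
      · rw [← Finset.add_sum_erase _ _ hi, hcong, ← hv0E E hE, hl E hE]
        simp only [if_true]
        ring

lemma weights_ne_zero [Fintype I] {Φ : (I → Pref Ω O) → Pref Ω O}
    (hSWF : ∀ p : I → Pref Ω O, IsProfile p → IsSEU (Φ p))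
    (hmono : RestrictedMonotonicity Φ) (hfaith : Faithful Φ) (hnbi : NoBeliefImposition Φ)
    (πa : I → Measure Ω) (ua : I → O → ℝ)
    (n : ℕ) : ∀ p : I → Pref Ω O, IsProfile p → RepC p πa ua → (concerned p).card = n →
      BeliefsAffIndep (concerned p) πa → UtilsLinIndep (concerned p) ua →
      ∀ π, RepresentsBelief π (Φ p) → ∀ v : I → ℝ, ∑ i ∈ concerned p, v i = 1 →
      (∀ E, MeasurableSet E → π.real E = ∑ i ∈ concerned p, v i * (πa i).real E) →
      ∀ i ∈ concerned p, v i ≠ 0 := by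
  classical
  induction n with
  | zero =>
    intro p hp _ hcard _ _ π _ v _ _ i hi
    simp [Finset.card_eq_zero.1 hcard] at hi
  | succ n ih =>
    intro p hp hR hcard haff hlin π hπ v hv hvE j hj
    by_cases hex : ∃ i ∈ concerned p, i ≠ j
    swap
    · push Not at hex
      have : concerned p = {j} := by
        ext k; rw [Finset.mem_singleton]
        exact ⟨hex k, fun h => h ▸ hj⟩
      rw [this, Finset.sum_singleton] at hv
      rw [hv]; exact one_ne_zero
    obtain ⟨i, hi, hij⟩ := hex
    have hp' := isProfile_updIndiff hp i
    have hce := concerned_updIndiff p i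
    have hji : j ∈ (concerned p).erase i := Finset.mem_erase.2 ⟨hij.symm, hj⟩
    obtain ⟨hb1, hu1, hr1⟩ := hR i hi
    have h1 : RepresentsBelief (πa i) (p i) := ⟨hb1, ua i, hu1, hr1⟩
    have hn := not_indiff_of_linIndep hSWF hmono hfaith hp hR hlin ⟨i, hi⟩
    -- extension of coefficient vectors by zero
    have hext : ∀ c d : I → ℝ, ∑ k ∈ concerned p, (if k = i then 0 else c k) * d k =
        ∑ k ∈ (concerned p).erase i, c k * d k := by
      intro c d
      rw [← Finset.add_sum_erase _ _ hi, if_pos rfl, zero_mul, zero_add]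
      refine Finset.sum_congr rfl fun k hk => ?_
      rw [if_neg (Finset.ne_of_mem_erase hk)]
    have haff' : BeliefsAffIndep (concerned (updIndiff p i)) πa := by
      rw [hce]
      intro c hc hcE k hk
      have := haff (fun k => if k = i then 0 else c k)
        (by have := hext c (fun _ => 1); simp only [mul_one] at this; rw [this, hc])
        (fun E hE => by rw [hext]; exact hcE E hE) k (Finset.mem_of_mem_erase hk)
      simpa [Finset.ne_of_mem_erase hk] using this
    have hlin' : UtilsLinIndep (concerned (updIndiff p i)) ua := by
      rw [hce]
      rintro c ⟨b, hb⟩ k hk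
      have := hlin (fun k => if k = i then 0 else c k)
        ⟨b, fun x => by rw [hext c (fun k => ua k x)]; exact hb x⟩ k (Finset.mem_of_mem_erase hk)
      simpa [Finset.ne_of_mem_erase hk] using this
    have hn0 := not_indiff_of_linIndep hSWF hmono hfaith hp' (hR.upd i) hlin'
      ⟨j, by rw [hce]; exact hji⟩
    obtain ⟨π0, u0, hb0, hu0, hr0⟩ := hSWF _ hp'
    have h0 : RepresentsBelief π0 (Φ (updIndiff p i)) := ⟨hb0, u0, hu0, hr0⟩
    have hcard' : (concerned (updIndiff p i)).card = n := by
      rw [hce, Finset.card_erase_of_mem hi, hcard]; rfl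
    obtain ⟨v0, hv0, hv0E⟩ := belief_span hSWF hmono hfaith πa ua n _ hp' (hR.upd i) hcard'
      hn0 π0 h0
    have hv0j := ih _ hp' (hR.upd i) hcard' haff' hlin' π0 h0 v0 hv0 hv0E j
      (by rw [hce]; exact hji)
    rw [hce] at hv0 hv0E
    obtain ⟨l, hl⟩ := key_belief hmono hp i h0 h1 hπ hn
    -- coefficient comparison
    have hcomp : ∀ (α β : ℝ) (c : I → ℝ) (d : I → ℝ),
        ∑ k ∈ concerned p, (c k - α * (if k = i then 0 else v0 k) - (if k = i then β else 0)) * d k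
        = ∑ k ∈ concerned p, c k * d k - α * ∑ k ∈ (concerned p).erase i, v0 k * d k
          - β * d i := by
      intro α β c d
      rw [← hext v0 d, Finset.mul_sum]
      have : β * d i = ∑ k ∈ concerned p, (if k = i then β else 0) * d k := by
        simp [ite_mul, hi]
      rw [this, ← Finset.sum_sub_distrib, ← Finset.sum_sub_distrib]
      exact Finset.sum_congr rfl fun k _ => by ring
    have hvj : v j = (1 + l) * v0 j := by
      have := haff (fun k => v k - (1 + l) * (if k = i then 0 else v0 k) -
        (if k = i then -l else 0))
        (by
          have := hcomp (1 + l) (-l) v (fun _ => 1)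
          simp only [mul_one] at this
          rw [this, hv, hv0]; ring)
        (fun E hE => by
          have := hcomp (1 + l) (-l) v (fun k => (πa k).real E)
          rw [← hvE E hE, ← hv0E E hE, hl E hE] at this
          refine this.trans ?_
          ring) j hj
      simp only [hij.symm, if_false] at this
      linarith
    rw [hvj]
    refine mul_ne_zero ?_ hv0j
    intro hl0
    have hb := hπ.1.1
    have hb1' := hb1.1
    have hb0' := hb0.1
    have hπeq : π = πa i := by
      ext E hE
      refine (measureReal_eq_measureReal_iff).1 ?_
      rw [hl E hE, hl0]
      linear_combination (-(πa i).real E) * hl0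
    refine hnbi i p hp hn0 hn (not_indiff_of_mem hi) π0 π (πa i) h0 hπ h1 ?_ hπeq
    intro h01
    have := haff (fun k => 0 - (-1) * (if k = i then 0 else v0 k) - (if k = i then 1 else 0))
      (by
        have := hcomp (-1) 1 (fun _ => 0) (fun _ => 1)
        simp only [mul_one] at this
        rw [this, hv0]; simp)
      (fun E hE => by
        have := hcomp (-1) 1 (fun _ => 0) (fun k => (πa k).real E)
        rw [← hv0E E hE, h01] at this
        refine this.trans ?_
        simp) i hi
    simp at this

end Social

theorem stmt1 {Ω O I : Type*} [mΩ : MeasurableSpace Ω] [mO : MeasurableSpace O]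
    [Fintype I] (hO : 4 ≤ Cardinal.mk O) (hI : 3 ≤ Fintype.card I)
    (Φ : (I → Pref Ω O) → Pref Ω O)
    (hSWF : ∀ p : I → Pref Ω O, IsProfile p → IsSEU (Φ p))
    (hmono : RestrictedMonotonicity Φ)
    (hfaith : Faithful Φ)
    (hnbi : NoBeliefImposition Φ)
    (p : I → Pref Ω O) (hp : IsProfile p)
    (πa : I → Measure Ω) (ua : I → O → ℝ)
    (hrep : ∀ i, NormRep (πa i) (ua i) (p i))
    (hnotCI : ¬ CompletelyIndifferent (Φ p)) :
    (∃ (πp : Measure Ω) (v : I → ℝ),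
        RepresentsBelief πp (Φ p) ∧ (∑ i ∈ concerned p, v i) = 1 ∧
        ∀ E : Set Ω, MeasurableSet E →
          (πp E).toReal = ∑ i ∈ concerned p, v i * (πa i E).toReal) ∧
    (BeliefsAffIndep (concerned p) πa → UtilsLinIndep (concerned p) ua →
      ∃ v : I → ℝ, (∀ i ∈ concerned p, v i ≠ 0) ∧ (∑ i ∈ concerned p, v i) = 1 ∧
        (∃ πp : Measure Ω, RepresentsBelief πp (Φ p) ∧
          ∀ E : Set Ω, MeasurableSet E →
            (πp E).toReal = ∑ i ∈ concerned p, v i * (πa i E).toReal) ∧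
        ∀ v' : I → ℝ, (∑ i ∈ concerned p, v' i) = 1 →
          (∃ πp : Measure Ω, RepresentsBelief πp (Φ p) ∧
            ∀ E : Set Ω, MeasurableSet E →
              (πp E).toReal = ∑ i ∈ concerned p, v' i * (πa i E).toReal) →
          ∀ i ∈ concerned p, v' i = v i) := by
  have hR : RepC p πa ua := fun i _ =>
    ⟨(hrep i).1, isUtility_of_norm (hrep i).2.1, (hrep i).2.2⟩
  obtain ⟨π, u, hb, hu, hr⟩ := hSWF p hp
  have hπ : RepresentsBelief π (Φ p) := ⟨hb, u, hu, hr⟩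
  obtain ⟨v, hv, hvE⟩ := belief_span hSWF hmono hfaith πa ua _ p hp hR rfl hnotCI π hπ
  refine ⟨⟨π, v, hπ, hv, hvE⟩, fun haff hlin => ⟨v, ?_, hv, ⟨π, hπ, hvE⟩, ?_⟩⟩
  · exact weights_ne_zero hSWF hmono hfaith hnbi πa ua _ p hp hR rfl haff hlin π hπ v hv hvE
  · rintro v' hv' ⟨π', hπ', hvE'⟩ i hi
    have := haff (fun k => v' k - v k) (by rw [Finset.sum_sub_distrib, hv, hv', sub_self])
      (fun E hE => by
        have h1 := hvE E hE
        have h2 : π'.real E = _ := hvE' E hE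
        have h3 := representsBelief_unique hnotCI hπ hπ' hE
        simp only [sub_mul, Finset.sum_sub_distrib]
        rw [h3, h2] at h1
        exact sub_eq_zero.2 h1) i hi
    linarith
end
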